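/- Let n > 4 be an integer, G = A_n the alternating group, F a field of characteristic 2, and M a finite-dimensional FG-module. Then dim H^2(G,M) ≤ (35/12)·dim M, i.e. 12·dim H^2(G,M) ≤ 35·dim M. -/

import Mathlib

namespace AltH2

section Cochains

variable {F G M : Type*} [Field F] [Group G] [AddCommGroup M] [Module F M]

/-- Inhomogeneous `2`-cocycles. -/
def Z2 (ρ : Representation F G M) : Submodule F (G → G → M) where
  carrier := {f | ∀ g h j, ρ g (f h j) - f (g * h) j + f g (h * j) - f g h = 0}
  add_mem' {a b} ha hb g h j := by
    have h1 := ha g h j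
    have h2 := hb g h j
    simp only [Pi.add_apply, map_add]
    linear_combination (norm := abel) h1 + h2
  zero_mem' g h j := by simp
  smul_mem' c f hf g h j := by
    have h1 := congrArg (c • ·) (hf g h j)
    simpa [smul_sub, smul_add] using h1

/-- The coboundary map from `1`-cochains to `2`-cochains. -/
def d1 (ρ : Representation F G M) : (G → M) →ₗ[F] (G → G → M) where
  toFun β g h := ρ g (β h) - β (g * h) + β g
  map_add' a b := by
    funext g h
    simp only [Pi.add_apply, map_add]
    abel
  map_smul' c a := by
    funext g h
    simp [smul_sub, smul_add]

theorem d1_apply (ρ : Representation F G M) (β : G → M) (g h : G) :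
    d1 ρ β g h = ρ g (β h) - β (g * h) + β g := rfl

/-- The `2`-coboundaries. -/
abbrev B2 (ρ : Representation F G M) : Submodule F (G → G → M) := LinearMap.range (d1 ρ)

theorem B2_le_Z2 (ρ : Representation F G M) : B2 ρ ≤ Z2 ρ := by
  rintro _ ⟨β, rfl⟩ g h j
  simp only [d1_apply, map_add, map_sub, map_mul, Module.End.mul_apply, mul_assoc]
  abel

/-- The dimension of the second cohomology, computed with inhomogeneous cochains. -/
noncomputable def h2 (ρ : Representation F G M) : ℕ :=
  Module.finrank F ((Z2 ρ).map (B2 ρ).mkQ)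

theorem finrank_range_le_of_ker {D V U : Type*} [AddCommGroup D] [Module F D]
    [AddCommGroup V] [Module F V] [AddCommGroup U] [Module F U] [FiniteDimensional F D]
    (a : D →ₗ[F] V) (b : D →ₗ[F] U) :
    Module.finrank F (LinearMap.range a) ≤
      Module.finrank F ((LinearMap.ker b).map a) + Module.finrank F (LinearMap.range b) := by
  have h1 := LinearMap.finrank_range_add_finrank_ker a
  have h2 := LinearMap.finrank_range_add_finrank_ker b
  have h3 := LinearMap.finrank_range_add_finrank_ker (a.domRestrict (LinearMap.ker b))
  have h4 : LinearMap.range (a.domRestrict (LinearMap.ker b)) = (LinearMap.ker b).map a := by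
    rw [LinearMap.domRestrict, LinearMap.range_comp, Submodule.range_subtype]
  rw [h4] at h3
  have h5 : Module.finrank F (LinearMap.ker (a.domRestrict (LinearMap.ker b))) ≤
      Module.finrank F (LinearMap.ker a) := by
    refine LinearMap.finrank_le_finrank_of_injective
      (f := ((LinearMap.ker b).subtype.restrict
        (p := LinearMap.ker (a.domRestrict (LinearMap.ker b))) (q := LinearMap.ker a)
        (fun x hx => by simpa using hx))) ?_
    intro x y hxy
    have := congrArg Subtype.val hxy
    exact Subtype.ext (Subtype.ext this)
  omega

theorem h2_le_of_sup [Finite G] [FiniteDimensional F M] (ρ : Representation F G M)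
    {S : Submodule F (G → G → M)} (hS : Z2 ρ ≤ S ⊔ B2 ρ) :
    h2 ρ ≤ Module.finrank F (S.map (B2 ρ).mkQ) := by
  apply Submodule.finrank_mono
  refine (Submodule.map_mono hS).trans ?_
  rw [Submodule.map_sup, Submodule.mkQ_map_self, sup_bot_eq]

theorem finrank_map_mkQ_le {V U : Type*} [AddCommGroup V] [Module F V] [FiniteDimensional F V]
    [AddCommGroup U] [Module F U] [FiniteDimensional F U] {S B : Submodule F V} (b : S →ₗ[F] U)
    (hb : ∀ f : S, b f = 0 → (f : V) ∈ B) :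
    Module.finrank F (S.map B.mkQ) ≤ Module.finrank F U := by
  have h := finrank_range_le_of_ker (B.mkQ.domRestrict S) b
  have h1 : LinearMap.range (B.mkQ.domRestrict S) = S.map B.mkQ := by
    rw [LinearMap.domRestrict, LinearMap.range_comp, Submodule.range_subtype]
  have h2 : (LinearMap.ker b).map (B.mkQ.domRestrict S) = ⊥ := by
    rw [eq_bot_iff]
    rintro _ ⟨f, hf, rfl⟩
    simpa using hb f hf
  rw [h1, h2, finrank_bot, zero_add] at h
  exact h.trans (Submodule.finrank_le _)

end Cochains

section Normalize

variable {F G M : Type*} [Field F] [Group G] [AddCommGroup M] [Module F M]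

theorem add_self_eq_zero (F : Type*) {M : Type*} [Field F] [CharP F 2] [AddCommGroup M] [Module F M]
    (x : M) : x + x = 0 := by
  have h : (2 : F) = 0 := CharTwo.two_eq_zero
  rw [← two_smul F x, h, zero_smul]

theorem neg_eq (F : Type*) {M : Type*} [Field F] [CharP F 2] [AddCommGroup M] [Module F M]
    (x : M) : -x = x := neg_eq_of_add_eq_zero_left (add_self_eq_zero F x)

theorem odd_nsmul (F : Type*) {M : Type*} [Field F] [CharP F 2] [AddCommGroup M] [Module F M]
    {k : ℕ} (hk : Odd k) (x : M) : k • x = x := by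
  obtain ⟨l, rfl⟩ := hk
  rw [add_smul, mul_comm, mul_smul, two_smul, add_self_eq_zero F, smul_zero, one_smul, zero_add]

/-- Cocycles that vanish as soon as one argument lies in the image of `φ`. -/
def ZN {R : Type*} [Group R] (ρ : Representation F G M) (φ : R →* G) :
    Submodule F (G → G → M) where
  carrier := {f | f ∈ Z2 ρ ∧ ∀ r g, f (φ r) g = 0 ∧ f g (φ r) = 0}
  add_mem' {a b} ha hb := ⟨add_mem ha.1 hb.1, fun r g => by
    simp [(ha.2 r g).1, (ha.2 r g).2, (hb.2 r g).1, (hb.2 r g).2]⟩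
  zero_mem' := ⟨zero_mem _, fun r g => by simp⟩
  smul_mem' c f hf := ⟨Submodule.smul_mem _ _ hf.1, fun r g => by
    simp [(hf.2 r g).1, (hf.2 r g).2]⟩

theorem Z2_le_ZN_sup [CharP F 2] {R : Type*} [Group R] [Finite R] (hR : Odd (Nat.card R))
    (ρ : Representation F G M) (φ : R →* G) : Z2 ρ ≤ ZN ρ φ ⊔ B2 ρ := by
  have := Fintype.ofFinite R
  rw [Nat.card_eq_fintype_card] at hR
  have step1 : ∀ f ∈ Z2 ρ, ∃ β, ∀ g r, (f - d1 ρ β) g (φ r) = 0 := by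
    intro f hf
    refine ⟨fun g => ∑ r, f g (φ r), fun g s => ?_⟩
    have h1 : ∀ r, ρ g (f (φ s) (φ r)) - f (g * φ s) (φ r) = f g (φ s) - f g (φ (s * r)) := by
      intro r
      have := hf g (φ s) (φ r)
      rw [map_mul]
      linear_combination (norm := abel) this
    have h2 := Finset.sum_congr rfl fun r (_ : r ∈ Finset.univ) => h1 r
    simp only [Finset.sum_sub_distrib, Finset.sum_const, Finset.card_univ, odd_nsmul F hR] at h2
    have h3 : ∑ r, f g (φ (s * r)) = ∑ r, f g (φ r) :=
      Fintype.sum_equiv (Equiv.mulLeft s) _ _ fun r => rfl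
    simp only [Pi.sub_apply, d1_apply, map_sum, h2, h3]
    abel
  have step2 : ∀ f ∈ Z2 ρ, (∀ g r, f g (φ r) = 0) →
      ∃ β, ∀ r g, (f - d1 ρ β) (φ r) g = 0 ∧ (f - d1 ρ β) g (φ r) = 0 := by
    intro f hf hf0
    have key : ∀ g h, (f - d1 ρ (fun g => ∑ r, ρ (φ r)⁻¹ (f (φ r) g))) g h =
        ∑ r, ρ (φ r)⁻¹ (f (φ r * g) h) - ρ g (∑ r, ρ (φ r)⁻¹ (f (φ r) h)) := by
      intro g h
      have h1 : ∀ r, ρ (φ r)⁻¹ (f (φ r) (g * h)) - ρ (φ r)⁻¹ (f (φ r) g) =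
          ρ (φ r)⁻¹ (f (φ r * g) h) - f g h := by
        intro r
        have := congrArg (ρ (φ r)⁻¹) (hf (φ r) g h)
        simp only [map_sub, map_add, map_zero, Representation.inv_self_apply] at this
        linear_combination (norm := abel) this
      have h2 := Finset.sum_congr rfl fun r (_ : r ∈ Finset.univ) => h1 r
      simp only [Finset.sum_sub_distrib, Finset.sum_const, Finset.card_univ, odd_nsmul F hR] at h2
      simp only [Pi.sub_apply, d1_apply]
      linear_combination (norm := abel) h2
    refine ⟨fun g => ∑ r, ρ (φ r)⁻¹ (f (φ r) g), fun s g => ⟨?_, ?_⟩⟩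
    · rw [key, sub_eq_zero, map_sum]
      refine Fintype.sum_equiv (Equiv.mulRight s) _ _ fun r => ?_
      have : (φ r)⁻¹ = φ s * (φ (r * s))⁻¹ := by simp
      rw [this, map_mul ρ, Module.End.mul_apply, Equiv.coe_mulRight, map_mul φ]
    · rw [key]
      simp [hf0]
  intro f hf
  obtain ⟨β, hβ⟩ := step1 f hf
  have hf' : f - d1 ρ β ∈ Z2 ρ := sub_mem hf (B2_le_Z2 ρ ⟨β, rfl⟩)
  obtain ⟨γ, hγ⟩ := step2 _ hf' hβ
  rw [Submodule.mem_sup]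
  refine ⟨_, ⟨sub_mem hf' (B2_le_Z2 ρ ⟨γ, rfl⟩), hγ⟩, d1 ρ (β + γ), ⟨_, rfl⟩, ?_⟩
  rw [map_add]
  abel

end Normalize

section Extension

variable {F G M R : Type*} [Field F] [Group G] [AddCommGroup M] [Module F M] [Group R]
  {ρ : Representation F G M} {φ : R →* G}

namespace ZN

theorem cocycle (f : ZN ρ φ) (g h j : G) :
    ρ g (f.1 h j) - f.1 (g * h) j + f.1 g (h * j) - f.1 g h = 0 := f.2.1 g h j

theorem map_left (f : ZN ρ φ) (r : R) (g : G) : f.1 (φ r) g = 0 := (f.2.2 r g).1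

theorem map_right (f : ZN ρ φ) (r : R) (g : G) : f.1 g (φ r) = 0 := (f.2.2 r g).2

theorem one_left (f : ZN ρ φ) (g : G) : f.1 1 g = 0 := by
  simpa using ZN.map_left f 1 g

theorem one_right (f : ZN ρ φ) (g : G) : f.1 g 1 = 0 := by
  simpa using ZN.map_right f 1 g

theorem map_mul_left (f : ZN ρ φ) (r : R) (g h : G) : f.1 (φ r * g) h = ρ (φ r) (f.1 g h) := by
  have := ZN.cocycle f (φ r) g h
  rw [ZN.map_left f, ZN.map_left f] at this
  linear_combination (norm := abel) -this

theorem mul_map_left (f : ZN ρ φ) (r : R) (g h : G) : f.1 (g * φ r) h = f.1 g (φ r * h) := by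
  have := ZN.cocycle f g (φ r) h
  rw [ZN.map_left f, ZN.map_right f, map_zero] at this
  linear_combination (norm := abel) -this

theorem mul_map_right (f : ZN ρ φ) (r : R) (g h : G) : f.1 g (h * φ r) = f.1 g h := by
  have := ZN.cocycle f g h (φ r)
  rw [ZN.map_right f, ZN.map_right f, map_zero] at this
  linear_combination (norm := abel) this

theorem conj (f : ZN ρ φ) (r : R) (g h : G) :
    f.1 (φ r * g * (φ r)⁻¹) (φ r * h * (φ r)⁻¹) = ρ (φ r) (f.1 g h) := by
  rw [← map_inv, mul_map_left, ← mul_assoc, mul_map_right, map_mul_left, map_inv,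
    inv_mul_cancel_left]

end ZN

/-- The group extension of `G` by `M` attached to a normalized cocycle. -/
@[ext]
structure CExt (f : ZN ρ φ) where
  /-- the component in the module -/
  m : M
  /-- the component in the group -/
  g : G

namespace CExt

variable {f : ZN ρ φ}

instance : Mul (CExt f) := ⟨fun a b => ⟨a.m + ρ a.g b.m + f.1 a.g b.g, a.g * b.g⟩⟩
instance : One (CExt f) := ⟨⟨0, 1⟩⟩
instance : Inv (CExt f) := ⟨fun a => ⟨-ρ a.g⁻¹ a.m - f.1 a.g⁻¹ a.g, a.g⁻¹⟩⟩

@[simp] theorem mul_m (a b : CExt f) : (a * b).m = a.m + ρ a.g b.m + f.1 a.g b.g := rfl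
@[simp] theorem mul_g (a b : CExt f) : (a * b).g = a.g * b.g := rfl
@[simp] theorem one_m : (1 : CExt f).m = 0 := rfl
@[simp] theorem one_g : (1 : CExt f).g = 1 := rfl
@[simp] theorem inv_g (a : CExt f) : a⁻¹.g = a.g⁻¹ := rfl

instance : Group (CExt f) :=
  Group.ofLeftAxioms
    (fun a b c => by
      ext
      · have := ZN.cocycle f a.g b.g c.g
        simp only [mul_m, mul_g, map_add, map_mul, Module.End.mul_apply]
        linear_combination (norm := abel) -this
      · simp [mul_assoc])
    (fun a => by ext <;> simp [ZN.one_left f])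
    (fun a => by
      ext
      · change -ρ a.g⁻¹ a.m - f.1 a.g⁻¹ a.g + ρ a.g⁻¹ a.m + f.1 a.g⁻¹ a.g = 0
        abel
      · simp)

/-- The projection of the extension to `G`. -/
def proj (f : ZN ρ φ) : CExt f →* G where
  toFun := CExt.g
  map_one' := rfl
  map_mul' _ _ := rfl

@[simp] theorem proj_apply (a : CExt f) : proj f a = a.g := rfl

/-- The canonical splitting over the group used for the normalization. -/
def lift (f : ZN ρ φ) : R →* CExt f where
  toFun r := ⟨0, φ r⟩
  map_one' := by ext <;> simp
  map_mul' r s := by ext <;> simp [ZN.map_left f]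

@[simp] theorem lift_m (r : R) : (lift f r).m = 0 := rfl
@[simp] theorem lift_g (r : R) : (lift f r).g = φ r := rfl

theorem lift_conj (r : R) (a : CExt f) :
    lift f r * a * (lift f r)⁻¹ = ⟨ρ (φ r) a.m, φ r * a.g * (φ r)⁻¹⟩ := by
  rw [mul_inv_eq_iff_eq_mul]
  ext <;> simp [ZN.map_left f, ZN.map_right f]

theorem eq_one_iff_of_g {a : CExt f} (h : a.g = 1) : a = 1 ↔ a.m = 0 :=
  ⟨fun h => by simp [h], fun h' => CExt.ext h' h⟩

/-- A splitting of the extension shows that the cocycle is a coboundary. -/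
theorem mem_B2_of_section (s : G →* CExt f) (hs : ∀ g, (s g).g = g) : f.1 ∈ B2 ρ := by
  refine ⟨fun g => -(s g).m, ?_⟩
  funext g h
  have := congrArg CExt.m (map_mul s g h)
  simp only [mul_m, hs] at this
  rw [d1_apply, map_neg, this]
  abel

theorem pow_three_m (a : CExt f) :
    (a ^ 3).m = a.m + ρ a.g a.m + ρ (a.g * a.g) a.m + (f.1 a.g a.g + f.1 (a.g * a.g) a.g) := by
  simp [pow_succ]
  abel

/-- The second component of `(a * b) ^ 2`. -/
theorem mul_pow_two_m (a b : CExt f) :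
    ((a * b) ^ 2).m = (a.m + ρ a.g b.m + f.1 a.g b.g) +
      ρ (a.g * b.g) (a.m + ρ a.g b.m + f.1 a.g b.g) + f.1 (a.g * b.g) (a.g * b.g) := by
  simp [pow_succ]

/-- A lift of `g` that has order dividing three if `g` has. -/
def can (f : ZN ρ φ) (g : G) : CExt f := ⟨f.1 g g + f.1 (g * g) g, g⟩

@[simp] theorem can_g (g : G) : (can f g).g = g := rfl

theorem can_pow_three [CharP F 2] {g : G} (hg : g ^ 3 = 1) : can f g ^ 3 = 1 := by
  have h1 : (⟨0, g⟩ : CExt f) ^ 3 = ⟨f.1 g g + f.1 (g * g) g, 1⟩ := by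
    ext
    · simp [pow_three_m]
    · simpa [pow_succ] using hg
  have h2 : ρ g (f.1 g g + f.1 (g * g) g) = f.1 g g + f.1 (g * g) g := by
    have := congrArg CExt.m ((Commute.refl (⟨0, g⟩ : CExt f)).pow_right 3)
    rw [h1] at this
    simpa [ZN.one_left, ZN.one_right] using this
  have hg' : (can f g ^ 3).g = 1 := by simpa [pow_succ] using hg
  rw [eq_one_iff_of_g hg', pow_three_m]
  simp only [can, map_mul, Module.End.mul_apply, h2]
  rw [add_self_eq_zero F, zero_add, add_self_eq_zero F]

theorem conj_can (r : R) (g : G) :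
    lift f r * can f g * (lift f r)⁻¹ = can f (φ r * g * (φ r)⁻¹) := by
  rw [lift_conj]
  have h : φ r * g * (φ r)⁻¹ * (φ r * g * (φ r)⁻¹) = φ r * (g * g) * (φ r)⁻¹ := by group
  ext
  · simp only [can, h, ZN.conj, map_add]
  · rfl

theorem conj_mul_pow (c a b : CExt f) :
    ((c * a * c⁻¹) * (c * b * c⁻¹)) ^ 2 = c * (a * b) ^ 2 * c⁻¹ := by
  rw [← conj_pow]
  group

theorem mul_pow_two_comm {E : Type*} [Group E] {a b : E} (h : (a * b) ^ 2 = 1) :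
    (b * a) ^ 2 = 1 := by
  have : (b * a) ^ 2 = a⁻¹ * (a * b) ^ 2 * a := by
    rw [sq, sq]
    group
  rw [this, h, mul_one, inv_mul_cancel]

end CExt

/-- The relator `(x_g x_h) ^ 2`, evaluated on the canonical lifts. -/
def rel (ρ : Representation F G M) (φ : R →* G) (g h : G) : ZN ρ φ →ₗ[F] M where
  toFun f := ((CExt.can f g * CExt.can f h) ^ 2).m
  map_add' f f' := by
    simp only [CExt.mul_pow_two_m, CExt.can, Submodule.coe_add, Pi.add_apply, map_add]
    abel
  map_smul' c f := by
    simp only [CExt.mul_pow_two_m, CExt.can, Submodule.coe_smul, Pi.smul_apply, map_add, map_smul,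
      smul_add, RingHom.id_apply]

theorem rel_apply (f : ZN ρ φ) (g h : G) :
    rel ρ φ g h f = ((CExt.can f g * CExt.can f h) ^ 2).m := rfl

theorem rel_conj (f : ZN ρ φ) (g h : G) (r : R) :
    rel ρ φ (φ r * g * (φ r)⁻¹) (φ r * h * (φ r)⁻¹) f = ρ (φ r) (rel ρ φ g h f) := by
  rw [rel_apply, ← CExt.conj_can, ← CExt.conj_can, CExt.conj_mul_pow, CExt.lift_conj, rel_apply]

end Extension

open Equiv

section Carmichael

variable {Ω : Type*} [DecidableEq Ω]

/-- The three-cycle `j ↦ a ↦ b ↦ j` (trivial if `j = a` or `j = b`). -/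
def cyc (a b j : Ω) : Perm Ω := (swap a b * swap a j) * (swap a b * swap a j)

variable {a b : Ω}

theorem cyc_self {j : Ω} (_ : j ≠ a) (hb : j ≠ b) (hab : a ≠ b) : cyc a b j j = a := by
  rw [cyc]
  simp [swap_apply_def, hab.symm, hb.symm]

theorem cyc_left {j : Ω} (ha : j ≠ a) (hb : j ≠ b) : cyc a b j a = b := by
  simp [cyc, swap_apply_def, ha, hb]

theorem cyc_right {j : Ω} (ha : j ≠ a) (hb : j ≠ b) (hab : a ≠ b) : cyc a b j b = j := by
  simp [cyc, swap_apply_def, hab.symm, hb, hb.symm, ha]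

theorem cyc_of_ne {i j : Ω} (ha : i ≠ a) (hb : i ≠ b) (hj : i ≠ j) : cyc a b j i = i := by
  simp [cyc, swap_apply_of_ne_of_ne ha hb, swap_apply_of_ne_of_ne ha hj]

theorem conj_cyc (g : Perm Ω) (a b j : Ω) : g * cyc a b j * g⁻¹ = cyc (g a) (g b) (g j) := by
  have h : ∀ x y, swap (g x) (g y) = g * swap x y * g⁻¹ := fun x y => by
    rw [mul_swap_eq_swap_mul, mul_inv_cancel_right]
  simp only [cyc, h]
  group

theorem cyc_pow_three (hab : a ≠ b) (j : Ω) : cyc a b j ^ 3 = 1 := by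
  by_cases ha : j = a
  · subst ha
    rw [cyc, swap_self]
    change (swap j b * 1 * (swap j b * 1)) ^ 3 = 1
    simp
  by_cases hb : j = b
  · subst hb; simp [cyc]
  ext i
  by_cases h1 : i = a
  · simp [pow_succ, h1, cyc_left ha hb, cyc_right ha hb hab, cyc_self ha hb hab]
  by_cases h2 : i = b
  · simp [pow_succ, h2, cyc_left ha hb, cyc_right ha hb hab, cyc_self ha hb hab]
  by_cases h3 : i = j
  · simp [pow_succ, h3, cyc_left ha hb, cyc_right ha hb hab, cyc_self ha hb hab]
  simp [pow_succ, cyc_of_ne h1 h2 h3]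

theorem cyc_mul_cyc_sq (hab : a ≠ b) {i j : Ω} (hia : i ≠ a) (hib : i ≠ b) (hja : j ≠ a)
    (hjb : j ≠ b) (hij : i ≠ j) : (cyc a b i * cyc a b j) ^ 2 = 1 := by
  ext k
  have e1 := cyc_self hia hib hab
  have e2 := cyc_left hia hib
  have e3 := cyc_right hia hib hab
  have f1 := cyc_self hja hjb hab
  have f2 := cyc_left hja hjb
  have f3 := cyc_right hja hjb hab
  have g1 := cyc_of_ne hia hib hij
  have g2 := cyc_of_ne hja hjb hij.symm
  by_cases h1 : k = a
  · simp [pow_succ, *]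
  by_cases h2 : k = b
  · simp [pow_succ, *]
  by_cases h3 : k = i
  · simp [pow_succ, *]
  by_cases h4 : k = j
  · simp [pow_succ, *]
  simp [pow_succ, cyc_of_ne h1 h2 h3, cyc_of_ne h1 h2 h4]

/-- The presentation of Carmichael. Elements `y j` of a group lying over the three-cycles
`cyc a b j` and satisfying `y j ^ 3 = 1` and `(y i * y j) ^ 2 = 1` generate a group that maps
injectively to the permutation group. -/
theorem eq_one_of_mem_closure {E : Type*} [Group E] (hab : a ≠ b) (π : E →* Perm Ω) (y : Ω → E)
    (S : Finset Ω) (ha : a ∉ S) (hb : b ∉ S) (hπ : ∀ j ∈ S, π (y j) = cyc a b j)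
    (h3 : ∀ j ∈ S, y j ^ 3 = 1) (h2 : ∀ i ∈ S, ∀ j ∈ S, i ≠ j → (y i * y j) ^ 2 = 1)
    {w : E} (hw : w ∈ Subgroup.closure (y '' S)) (h1 : π w = 1) : w = 1 := by
  induction S using Finset.induction_on generalizing w with
  | empty => simpa using hw
  | insert j S hj ih =>
    set Y := Subgroup.closure (y '' (S : Set Ω)) with hY
    have hja : j ≠ a := fun h => ha (by simp [h])
    have hjb : j ≠ b := fun h => hb (by simp [h])
    have hyY : ∀ i ∈ S, y i ∈ Y := fun i hi => Subgroup.subset_closure ⟨i, hi, rfl⟩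
    have hSj : ∀ i ∈ S, i ≠ j := fun i hi h => hj (h ▸ hi)
    have ins : ∀ i ∈ S, i ∈ insert j S := fun i hi => Finset.mem_insert_of_mem hi
    have insj : j ∈ insert j S := Finset.mem_insert_self _ _
    have hfix : ∀ u ∈ Y, π u j = j := by
      intro u hu
      induction hu using Subgroup.closure_induction with
      | mem x hx =>
        obtain ⟨i, hi, rfl⟩ := hx
        rw [hπ i (ins i hi), cyc_of_ne hja hjb (hSj i hi).symm]
      | one => simp
      | mul x z _ _ hx hz => simp [hx, hz]
      | inv x _ hx => rw [map_inv, Perm.inv_eq_iff_eq, hx]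
    have inv2 : ∀ {u v : E}, (u * v) ^ 2 = 1 → u * v = v⁻¹ * u⁻¹ := by
      intro u v h
      rw [← mul_inv_rev, eq_inv_iff_mul_eq_one, ← sq, h]
    have inv3 : ∀ {u : E}, u ^ 3 = 1 → u * u = u⁻¹ := by
      intro u h
      rw [eq_inv_iff_mul_eq_one, ← h, pow_succ, sq]
    have hyj := inv3 (h3 j insj)
    let T : E → Prop := fun w => w ∈ Y ∨ (∃ u ∈ Y, w = u * y j) ∨ (∃ u ∈ Y, w = u * (y j)⁻¹) ∨
      ∃ i ∈ S, ∃ u ∈ Y, w = u * ((y j)⁻¹ * y i)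
    have swapD : ∀ i ∈ S, y j * (y i)⁻¹ = (y i)⁻¹ * ((y j)⁻¹ * y i) := by
      intro i hi
      have e := inv2 (h2 j insj i (ins i hi) (hSj i hi).symm)
      rw [← inv3 (h3 i (ins i hi)), ← mul_assoc, e, ← inv3 (h3 i (ins i hi))]
      simp only [mul_assoc]
    have Tmul : ∀ v, T v → ∀ k ∈ insert j S, T (v * y k) := by
      intro v hv k hk
      rw [Finset.mem_insert] at hk
      rcases hv with hv | ⟨u, hu, rfl⟩ | ⟨u, hu, rfl⟩ | ⟨i, hi, u, hu, rfl⟩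
      · rcases hk with rfl | hk
        · exact Or.inr (Or.inl ⟨v, hv, rfl⟩)
        · exact Or.inl (mul_mem hv (hyY k hk))
      · rcases hk with rfl | hk
        · exact Or.inr (Or.inr (Or.inl ⟨u, hu, by rw [mul_assoc, hyj]⟩))
        · refine Or.inr (Or.inr (Or.inl ⟨u * (y k)⁻¹, mul_mem hu (inv_mem (hyY k hk)), ?_⟩))
          rw [mul_assoc, inv2 (h2 j insj k (ins k hk) (hSj k hk).symm), mul_assoc]
      · rcases hk with rfl | hk
        · exact Or.inl (by simpa using hu)
        · exact Or.inr (Or.inr (Or.inr ⟨k, hk, u, hu, by rw [mul_assoc]⟩))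
      · rcases hk with rfl | hk
        · refine Or.inr (Or.inr (Or.inr ⟨i, hi, u * (y i)⁻¹, mul_mem hu (inv_mem (hyY i hi)), ?_⟩))
          have e := inv2 (h2 i (ins i hi) k insj (hSj i hi))
          have hk2 : (y k)⁻¹ * (y k)⁻¹ = y k := by rw [← mul_inv_rev, hyj, inv_inv]
          rw [mul_assoc, mul_assoc, e, mul_assoc u, ← swapD i hi, ← mul_assoc (y k)⁻¹, hk2]
        · by_cases hki : k = i
          · subst hki
            refine Or.inr (Or.inl ⟨u * y k, mul_mem hu (hyY k hk), ?_⟩)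
            rw [mul_assoc, mul_assoc, inv3 (h3 k (ins k hk)),
              ← inv2 (h2 k (ins k hk) j insj (hSj k hk)), mul_assoc]
          · refine Or.inr (Or.inr (Or.inr ⟨i, hi, u * y k * (y i)⁻¹,
              mul_mem (mul_mem hu (hyY k hk)) (inv_mem (hyY i hi)), ?_⟩))
            rw [mul_assoc (u * y k), ← swapD i hi, mul_assoc, mul_assoc,
              inv2 (h2 i (ins i hi) k (ins k hk) (Ne.symm hki)), ← mul_assoc (y j)⁻¹,
              ← inv2 (h2 k (ins k hk) j insj (hSj k hk))]
            simp only [mul_assoc]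
    have hT : T w := by
      clear h1
      induction hw using Subgroup.closure_induction_right with
      | one => exact Or.inl (one_mem _)
      | mul_right x _ z hz hx =>
        obtain ⟨k, hk, rfl⟩ := hz
        exact Tmul x hx k hk
      | mul_inv_cancel x _ z hz hx =>
        obtain ⟨k, hk, rfl⟩ := hz
        rw [← inv3 (h3 k hk), ← mul_assoc]
        exact Tmul _ (Tmul x hx k hk) k hk
    rcases hT with hw | ⟨u, hu, rfl⟩ | ⟨u, hu, rfl⟩ | ⟨i, hi, u, hu, rfl⟩
    · exact ih (fun h => ha (ins a h)) (fun h => hb (ins b h)) (fun i hi => hπ i (ins i hi))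
        (fun i hi => h3 i (ins i hi))
        (fun i hi k hk => h2 i (ins i hi) k (ins k hk)) hw h1
    all_goals
      exfalso
      have e := congrArg (fun σ : Perm Ω => σ j) h1
      have e2 : (cyc a b j)⁻¹ j = b := by rw [Perm.inv_eq_iff_eq, cyc_right hja hjb hab]
    · simp only [map_mul, hπ j insj, Perm.mul_apply, cyc_self hja hjb hab, Perm.one_apply] at e
      exact hja ((π u).injective ((hfix u hu).trans e.symm))
    · simp only [map_mul, map_inv, hπ j insj, Perm.mul_apply, e2, Perm.one_apply] at e
      exact hjb ((π u).injective ((hfix u hu).trans e.symm))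
    · simp only [map_mul, map_inv, hπ j insj, hπ i (ins i hi), Perm.mul_apply,
        cyc_of_ne hja hjb (hSj i hi).symm, e2, Perm.one_apply] at e
      exact hjb ((π u).injective ((hfix u hu).trans e.symm))

/-- The three-cycles `cyc a b j` generate the even permutations. -/
theorem mem_closure_cyc [Fintype Ω] (hab : a ≠ b) (S : Finset Ω) (ha : a ∉ S) (hb : b ∉ S)
    {σ : Perm Ω} (hσ : Perm.sign σ = 1) (hS : ∀ i, i ∉ S → i ≠ a → i ≠ b → σ i = i) :
    σ ∈ Subgroup.closure (cyc a b '' S) := by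
  induction S using Finset.induction_on generalizing σ with
  | empty =>
    have h : ∀ i, i ≠ a → i ≠ b → σ i = i := fun i => hS i (by simp)
    suffices σ = 1 by simp [this]
    have haa : σ a = a := by
      by_contra hne
      have h1 : σ a = b := by
        by_contra h1
        exact hne (σ.injective (h _ hne h1))
      have h2 : σ b = a := by
        by_contra h2
        by_cases h3 : σ b = b
        · exact hab (σ.injective (h1.trans h3.symm))
        · exact h3 (σ.injective (h _ h2 h3))
      have : σ = swap a b := by
        ext i
        by_cases hia : i = a
        · simp [hia, h1]
        by_cases hib : i = b
        · simp [hib, h2]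
        rw [h i hia hib, swap_apply_of_ne_of_ne hia hib]
      rw [this, Perm.sign_swap hab] at hσ
      exact absurd hσ (by decide)
    have hbb : σ b = b := by
      by_contra hne
      by_cases h1 : σ b = a
      · exact hab (σ.injective (haa.trans h1.symm))
      · exact hne (σ.injective (h _ h1 hne))
    ext i
    by_cases hia : i = a
    · simp [hia, haa]
    by_cases hib : i = b
    · simp [hib, hbb]
    simpa using h i hia hib
  | insert j S hj ih =>
    have hja : j ≠ a := fun h => ha (by simp [h])
    have hjb : j ≠ b := fun h => hb (by simp [h])
    set C := Subgroup.closure (cyc a b '' ((insert j S : Finset Ω) : Set Ω)) with hC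
    have hgen : ∀ i ∈ insert j S, cyc a b i ∈ C := fun i hi => Subgroup.subset_closure ⟨i, hi, rfl⟩
    have hsgn : ∀ i, Perm.sign (cyc a b i) = 1 := fun i => by
      rw [cyc, map_mul, Int.units_mul_self]
    have main : ∀ t ∈ C, Perm.sign t = 1 → (∀ i, i ∉ insert j S → i ≠ a → i ≠ b → t i = i) →
        t j = σ j → σ ∈ C := by
      intro t ht hts htS htj
      have : t⁻¹ * σ ∈ Subgroup.closure (cyc a b '' S) := by
        refine ih (fun h => ha (Finset.mem_insert_of_mem h))
          (fun h => hb (Finset.mem_insert_of_mem h)) (by simp [hσ, hts]) fun i hi hia hib => ?_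
        rw [Perm.mul_apply, Perm.inv_eq_iff_eq]
        by_cases hij : i = j
        · rw [hij, htj]
        · rw [hS i (by simp [hi, hij]) hia hib, htS i (by simp [hi, hij]) hia hib]
      have h2 := mul_mem ht (Subgroup.closure_mono
        (Set.image_mono (by simp)) this : t⁻¹ * σ ∈ C)
      simpa using h2
    have hfix : ∀ k ∈ insert j S, ∀ i, i ∉ insert j S → i ≠ a → i ≠ b → cyc a b k i = i :=
      fun k hk i hi hia hib => cyc_of_ne hia hib fun h => hi (h ▸ hk)
    have insj := Finset.mem_insert_self j S
    by_cases h0 : σ j = j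
    · exact main 1 (one_mem _) (by simp) (by simp) (by simp [h0])
    by_cases h1 : σ j = a
    · exact main _ (hgen j insj) (hsgn j) (hfix j insj) (by rw [cyc_self hja hjb hab, h1])
    by_cases h2 : σ j = b
    · refine main _ (inv_mem (hgen j insj)) (by simp [hsgn]) (fun i hi hia hib => ?_) ?_
      · rw [Perm.inv_eq_iff_eq, hfix j insj i hi hia hib]
      · rw [Perm.inv_eq_iff_eq, h2, cyc_right hja hjb hab]
    have h3 : σ j ∈ S := by
      by_contra h3
      exact h0 (σ.injective (hS (σ j) (by simp [h3, h0]) h1 h2))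
    have h4 := Finset.mem_insert_of_mem (b := j) h3
    refine main ((cyc a b (σ j))⁻¹ * cyc a b j) (mul_mem (inv_mem (hgen _ h4)) (hgen j insj))
      (by simp [hsgn]) (fun i hi hia hib => ?_) ?_
    · rw [Perm.mul_apply, Perm.inv_eq_iff_eq, hfix j insj i hi hia hib,
        hfix _ h4 i hi hia hib]
    · rw [Perm.mul_apply, Perm.inv_eq_iff_eq, cyc_self hja hjb hab, cyc_self h1 h2 hab]

end Carmichael

section AltCoc

variable {Ω : Type*} [DecidableEq Ω] [Fintype Ω]

/-- `cyc` as an element of the alternating group. -/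
def xA (a b j : Ω) : alternatingGroup Ω :=
  ⟨cyc a b j, by rw [Perm.mem_alternatingGroup, cyc, map_mul, Int.units_mul_self]⟩

@[simp] theorem coe_xA (a b j : Ω) : (xA a b j : Perm Ω) = cyc a b j := rfl

theorem conj_xA (g : alternatingGroup Ω) (a b j : Ω) :
    g * xA a b j * g⁻¹ = xA ((g : Perm Ω) a) ((g : Perm Ω) b) ((g : Perm Ω) j) :=
  Subtype.ext (by simpa using conj_cyc (g : Perm Ω) a b j)

theorem xA_pow_three {a b : Ω} (hab : a ≠ b) (j : Ω) : xA a b j ^ 3 = 1 :=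
  Subtype.ext (by simpa using cyc_pow_three hab j)

theorem xA_mul_xA_sq {a b : Ω} (hab : a ≠ b) {i j : Ω} (hia : i ≠ a) (hib : i ≠ b) (hja : j ≠ a)
    (hjb : j ≠ b) (hij : i ≠ j) : (xA a b i * xA a b j) ^ 2 = 1 :=
  Subtype.ext (by simpa using cyc_mul_cyc_sq hab hia hib hja hjb hij)

/-- A subgroup containing all three-cycles through two given points is everything. -/
theorem eq_top_of_xA_mem {a b : Ω} (hab : a ≠ b) (H : Subgroup (alternatingGroup Ω))
    (h : ∀ j, j ≠ a → j ≠ b → xA a b j ∈ H) : H = ⊤ := by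
  rw [eq_top_iff]
  rintro g -
  have hg : (g : Perm Ω) ∈ Subgroup.closure (cyc a b '' (Finset.univ \ {a, b} : Finset Ω)) :=
    mem_closure_cyc hab _ (by simp) (by simp) (Perm.mem_alternatingGroup.1 g.2)
      (fun i hi hia hib => by simp [hia, hib] at hi)
  have hle : Subgroup.closure (cyc a b '' (Finset.univ \ {a, b} : Finset Ω)) ≤
      H.map (alternatingGroup Ω).subtype := by
    rw [Subgroup.closure_le]
    rintro _ ⟨j, hj, rfl⟩
    simp only [Finset.coe_sdiff, Finset.coe_univ, Finset.coe_insert, Finset.coe_singleton,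
      Set.mem_sdiff, Set.mem_univ, true_and, Set.mem_insert_iff, Set.mem_singleton_iff,
      not_or] at hj
    exact ⟨xA a b j, h j hj.1 hj.2, rfl⟩
  obtain ⟨g', hg', e⟩ := hle hg
  rwa [← Subtype.ext (e : (g' : Perm Ω) = g)]

variable {F M R : Type*} [Field F] [AddCommGroup M] [Module F M] [Group R]
  {ρ : Representation F (alternatingGroup Ω) M} {φ : R →* alternatingGroup Ω} {f : ZN ρ φ}

theorem mem_B2_of_lifts {a b : Ω} (hab : a ≠ b) (Y : Ω → CExt f)
    (hY : ∀ j, j ≠ a → j ≠ b → (Y j).g = xA a b j)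
    (h3 : ∀ j, j ≠ a → j ≠ b → Y j ^ 3 = 1)
    (h2 : ∀ i j, i ≠ a → i ≠ b → j ≠ a → j ≠ b → i ≠ j → (Y i * Y j) ^ 2 = 1) :
    f.1 ∈ B2 ρ := by
  set S : Finset Ω := Finset.univ \ {a, b} with hS
  have hmem : ∀ j, j ∈ S ↔ j ≠ a ∧ j ≠ b := fun j => by simp [hS]
  set C := Subgroup.closure (Y '' (S : Set Ω)) with hC
  let ψ : C →* alternatingGroup Ω := (CExt.proj f).comp C.subtype
  have hinj : Function.Injective ψ := by
    rw [injective_iff_map_eq_one]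
    intro w hw
    refine Subtype.ext (eq_one_of_mem_closure hab
      ((alternatingGroup Ω).subtype.comp (CExt.proj f)) Y S (by simp [hS]) (by simp [hS])
      (fun j hj => ?_) (fun j hj => ?_) (fun i hi j hj hij => ?_) w.2 ?_)
    · simp [hY j ((hmem j).1 hj).1 ((hmem j).1 hj).2]
    · exact h3 j ((hmem j).1 hj).1 ((hmem j).1 hj).2
    · exact h2 i j ((hmem i).1 hi).1 ((hmem i).1 hi).2 ((hmem j).1 hj).1 ((hmem j).1 hj).2 hij
    · exact congrArg Subtype.val hw
  have hsurj : Function.Surjective ψ := by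
    rw [← MonoidHom.range_eq_top]
    refine eq_top_of_xA_mem hab _ fun j hja hjb => ?_
    exact ⟨⟨Y j, Subgroup.subset_closure ⟨j, (hmem j).2 ⟨hja, hjb⟩, rfl⟩⟩, hY j hja hjb⟩
  let e := MulEquiv.ofBijective ψ ⟨hinj, hsurj⟩
  exact CExt.mem_B2_of_section (C.subtype.comp e.symm.toMonoidHom) fun g => e.apply_symm_apply g

theorem mem_B2_of_rel_eq_zero [CharP F 2] {a b : Ω} (hab : a ≠ b)
    (h : ∀ i j, i ≠ a → i ≠ b → j ≠ a → j ≠ b → i ≠ j →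
      (CExt.can f (xA a b i) * CExt.can f (xA a b j)) ^ 2 = 1) : f.1 ∈ B2 ρ :=
  mem_B2_of_lifts hab (fun j => CExt.can f (xA a b j)) (fun _ _ _ => rfl)
    (fun j _ _ => CExt.can_pow_three (xA_pow_three hab j)) h

theorem can_mul_pow_two_eq_one_iff {a b : Ω} (hab : a ≠ b) {i j : Ω} (hia : i ≠ a) (hib : i ≠ b)
    (hja : j ≠ a) (hjb : j ≠ b) (hij : i ≠ j) :
    (CExt.can f (xA a b i) * CExt.can f (xA a b j)) ^ 2 = 1 ↔
      rel ρ φ (xA a b i) (xA a b j) f = 0 :=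
  CExt.eq_one_iff_of_g (xA_mul_xA_sq hab hia hib hja hjb hij)

/-- The second cohomology is bounded by the relators, one for every orbit of the normalizing group
on pairs of points. -/
theorem h2_le_sum [CharP F 2] [FiniteDimensional F M] [Finite R] (hR : Odd (Nat.card R))
    (ρ : Representation F (alternatingGroup Ω) M) (φ : R →* alternatingGroup Ω)
    {a b : Ω} (hab : a ≠ b) (ha : ∀ r, (φ r : Perm Ω) a = a) (hb : ∀ r, (φ r : Perm Ω) b = b)
    {ι : Type*} [Fintype ι] (p : ι → Ω × Ω) (W : ι → Submodule F M)
    (hp : ∀ i j, i ≠ a → i ≠ b → j ≠ a → j ≠ b → i ≠ j → ∃ r k,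
      ((φ r : Perm Ω) (p k).1 = i ∧ (φ r : Perm Ω) (p k).2 = j) ∨
      ((φ r : Perm Ω) (p k).1 = j ∧ (φ r : Perm Ω) (p k).2 = i))
    (hW : ∀ k f, rel ρ φ (xA a b (p k).1) (xA a b (p k).2) f ∈ W k) :
    h2 ρ ≤ ∑ k, Module.finrank F (W k) := by
  refine (h2_le_of_sup ρ (Z2_le_ZN_sup hR ρ φ)).trans ?_
  rw [← Module.finrank_pi_fintype]
  refine finrank_map_mkQ_le (LinearMap.pi fun k =>
    (rel ρ φ (xA a b (p k).1) (xA a b (p k).2)).codRestrict (W k) (hW k)) fun f hf => ?_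
  have hk : ∀ k, rel ρ φ (xA a b (p k).1) (xA a b (p k).2) f = 0 := fun k =>
    congrArg Subtype.val (congrFun hf k)
  have hr : ∀ r k, rel ρ φ (xA a b ((φ r : Perm Ω) (p k).1)) (xA a b ((φ r : Perm Ω) (p k).2)) f
      = 0 := by
    intro r k
    have := rel_conj f (xA a b (p k).1) (xA a b (p k).2) r
    rwa [conj_xA, conj_xA, ha, hb, hk, map_zero] at this
  refine mem_B2_of_rel_eq_zero hab fun i j hia hib hja hjb hij => ?_
  obtain ⟨r, k, ⟨rfl, rfl⟩ | ⟨rfl, rfl⟩⟩ := hp i j hia hib hja hjb hij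
  · exact (can_mul_pow_two_eq_one_iff hab hia hib hja hjb hij).2 (hr r k)
  · exact CExt.mul_pow_two_comm
      ((can_mul_pow_two_eq_one_iff hab hja hjb hia hib hij.symm).2 (hr r k))

end AltCoc

section Trivial

variable {Ω : Type*} [DecidableEq Ω] [Fintype Ω] {F M : Type*} [Field F] [AddCommGroup M]
  [Module F M]

theorem h2_le_of_trivial [CharP F 2] [FiniteDimensional F M]
    (ρ : Representation F (alternatingGroup Ω) M) (hρ : ∀ g m, ρ g m = m) {a b p q : Ω}
    (hab : a ≠ b) (hpa : p ≠ a) (hpb : p ≠ b) (hqa : q ≠ a) (hqb : q ≠ b) (hpq : p ≠ q) :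
    h2 ρ ≤ Module.finrank F M := by
  have hR : Odd (Nat.card Unit) := by simp
  refine (h2_le_of_sup ρ (Z2_le_ZN_sup hR ρ (1 : Unit →* alternatingGroup Ω))).trans ?_
  refine finrank_map_mkQ_le (rel ρ 1 (xA a b p) (xA a b q)) fun f hf => ?_
  have huniq : ∀ A B : CExt f, A.g = B.g → A ^ 3 = 1 → B ^ 3 = 1 → A = B := by
    intro A B hg hA hB
    have h1 := congrArg CExt.m (hA.trans hB.symm)
    simp only [CExt.pow_three_m, hρ, add_self_eq_zero F, zero_add, hg] at h1
    exact CExt.ext (add_right_cancel h1) hg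
  have hstep : ∀ i j k, i ≠ a → i ≠ b → j ≠ a → j ≠ b → k ≠ a → k ≠ b → i ≠ j → j ≠ k → i ≠ k →
      (CExt.can f (xA a b i) * CExt.can f (xA a b j)) ^ 2 = 1 →
      (CExt.can f (xA a b j) * CExt.can f (xA a b k)) ^ 2 = 1 := by
    intro i j k hia hib hja hjb hka hkb hij hjk hik h
    let c : CExt f := ⟨0, xA j k i⟩
    have ca : cyc j k i a = a := cyc_of_ne hja.symm hka.symm hia.symm
    have cb : cyc j k i b = b := cyc_of_ne hjb.symm hkb.symm hib.symm
    have ci : cyc j k i i = j := cyc_self hij hik hjk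
    have cj : cyc j k i j = k := cyc_left hij hik
    have hc : ∀ l l', cyc j k i l = l' →
        c * CExt.can f (xA a b l) * c⁻¹ = CExt.can f (xA a b l') := by
      intro l l' hl
      refine huniq _ _ ?_ ?_ (CExt.can_pow_three (xA_pow_three hab _))
      · simp only [CExt.mul_g, CExt.inv_g, CExt.can_g, c, conj_xA, coe_xA, ca, cb, hl]
      · rw [conj_pow, CExt.can_pow_three (xA_pow_three hab _), mul_one, mul_inv_cancel]
    rw [← hc i j ci, ← hc j k cj, CExt.conj_mul_pow, h, mul_one, mul_inv_cancel]
  have h0 : (CExt.can f (xA a b p) * CExt.can f (xA a b q)) ^ 2 = 1 :=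
    (can_mul_pow_two_eq_one_iff hab hpa hpb hqa hqb hpq).2 hf
  have h1 : ∀ k, k ≠ a → k ≠ b → k ≠ q →
      (CExt.can f (xA a b q) * CExt.can f (xA a b k)) ^ 2 = 1 := by
    intro k hka hkb hkq
    by_cases hkp : k = p
    · subst hkp
      exact CExt.mul_pow_two_comm h0
    · exact hstep p q k hpa hpb hqa hqb hka hkb hpq (Ne.symm hkq) (Ne.symm hkp) h0
  refine mem_B2_of_rel_eq_zero hab fun i j hia hib hja hjb hij => ?_
  by_cases hiq : i = q
  · subst hiq
    exact h1 j hja hjb hij.symm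
  by_cases hjq : j = q
  · subst hjq
    exact CExt.mul_pow_two_comm (h1 i hia hib hij)
  exact hstep q i j hqa hqb hia hib hja hjb (Ne.symm hiq) hij (Ne.symm hjq) (h1 i hia hib hiq)

end Trivial

section Functoriality

variable {F G K M N : Type*} [Field F] [Group G] [Group K] [AddCommGroup M] [Module F M]
  [AddCommGroup N] [Module F N]

/-- Pulling back cochains along a group homomorphism. -/
def pull (F M : Type*) [Field F] [AddCommGroup M] [Module F M] (θ : K →* G) :
    (G → G → M) →ₗ[F] (K → K → M) where
  toFun f g h := f (θ g) (θ h)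
  map_add' _ _ := rfl
  map_smul' _ _ := rfl

theorem pull_mem_Z2 {ρ : Representation F G M} (θ : K →* G) {f : G → G → M} (hf : f ∈ Z2 ρ) :
    pull F M θ f ∈ Z2 (ρ.comp θ) := by
  intro g h j
  have := hf (θ g) (θ h) (θ j)
  simpa [pull] using this

/-- Applying a linear map to cochains. -/
def push (G : Type*) (l : M →ₗ[F] N) : (G → G → M) →ₗ[F] (G → G → N) where
  toFun f g h := l (f g h)
  map_add' _ _ := by funext; simp
  map_smul' _ _ := by funext; simp

theorem finrank_map_mkQ_comp_le [Finite G] [Finite K] [FiniteDimensional F M]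
    [FiniteDimensional F N] {ρ : Representation F G M} {σ : Representation F K N}
    (T : (K → K → N) →ₗ[F] (G → G → M)) (hT : ∀ β, T (d1 σ β) ∈ B2 ρ) :
    Module.finrank F (((Z2 σ).map T).map (B2 ρ).mkQ) ≤ h2 σ := by
  have hle : B2 σ ≤ (B2 ρ).comap T := by
    rintro _ ⟨β, rfl⟩
    exact hT β
  have : ((Z2 σ).map T).map (B2 ρ).mkQ = ((Z2 σ).map (B2 σ).mkQ).map ((B2 σ).mapQ (B2 ρ) T hle) := by
    rw [← Submodule.map_comp, ← Submodule.map_comp, Submodule.mapQ_mkQ]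
  rw [this]
  exact Submodule.finrank_map_le _ _

theorem h2_le_add [Finite G] [FiniteDimensional F M] (ρ : Representation F G M)
    (W : Submodule F M) (hW : ∀ g, W ≤ W.comap (ρ g)) :
    h2 ρ ≤ h2 (ρ.subrepresentation W hW) + h2 (ρ.quotient W hW) := by
  set σ := ρ.subrepresentation W hW
  set τ := ρ.quotient W hW
  have h := finrank_range_le_of_ker ((B2 ρ).mkQ.domRestrict (Z2 ρ))
    (((B2 τ).mkQ ∘ₗ push G W.mkQ).domRestrict (Z2 ρ))
  have h1 : LinearMap.range ((B2 ρ).mkQ.domRestrict (Z2 ρ)) = (Z2 ρ).map (B2 ρ).mkQ := by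
    rw [LinearMap.domRestrict, LinearMap.range_comp, Submodule.range_subtype]
  rw [h1] at h
  refine h.trans (add_le_add ?_ (Submodule.finrank_mono ?_))
  · refine le_trans (Submodule.finrank_mono ?_) (finrank_map_mkQ_comp_le (ρ := ρ) (σ := σ)
      (push G W.subtype) fun β => ⟨fun g => β g, rfl⟩)
    rintro _ ⟨f, hf, rfl⟩
    have hf : push G W.mkQ f.1 ∈ B2 τ := by simpa using hf
    obtain ⟨β, hβ⟩ := hf
    choose γ hγ using fun g => W.mkQ_surjective (β g)
    have hmem : ∀ g h, (f.1 - d1 ρ γ) g h ∈ W := by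
      intro g h
      have := congrFun (congrFun hβ g) h
      rw [← Submodule.Quotient.mk_eq_zero, ← Submodule.mkQ_apply]
      simp only [Pi.sub_apply, d1_apply, map_sub, map_add]
      rw [sub_eq_zero]
      refine this.symm.trans ?_
      rw [d1_apply, ← hγ, ← hγ, ← hγ]
      rfl
    have hZ : f.1 - d1 ρ γ ∈ Z2 ρ := sub_mem f.2 (B2_le_Z2 ρ ⟨γ, rfl⟩)
    refine ⟨f.1 - d1 ρ γ, ⟨fun g h => ⟨_, hmem g h⟩, fun g h j => Subtype.ext (hZ g h j), rfl⟩, ?_⟩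
    rw [map_sub, LinearMap.domRestrict_apply, sub_eq_self, Submodule.mkQ_apply,
      Submodule.Quotient.mk_eq_zero]
    exact ⟨γ, rfl⟩
  · rintro _ ⟨f, rfl⟩
    refine ⟨push G W.mkQ f.1, fun g h j => ?_, rfl⟩
    exact congrArg W.mkQ (f.2 g h j)

/-- Restriction to a subgroup of odd index is injective on cohomology in characteristic two. -/
theorem h2_le_comp_of_odd_index [CharP F 2] [Finite G] [FiniteDimensional F M]
    (ρ : Representation F G M) (θ : K →* G) (hθ : Function.Injective θ)
    (hodd : Odd θ.range.index) : h2 ρ ≤ h2 (ρ.comp θ) := by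
  have : Finite K := Finite.of_injective θ hθ
  have := Fintype.ofFinite (G ⧸ θ.range)
  refine finrank_map_mkQ_le (LinearMap.codRestrict ((Z2 (ρ.comp θ)).map (B2 (ρ.comp θ)).mkQ)
    (((B2 (ρ.comp θ)).mkQ ∘ₗ pull F M θ) ∘ₗ (Z2 ρ).subtype)
    fun f => ⟨_, pull_mem_Z2 θ f.2, rfl⟩) fun f hf => ?_
  have hf : pull F M θ f.1 ∈ B2 (ρ.comp θ) := by
    exact (Submodule.Quotient.mk_eq_zero _).1 (congrArg Subtype.val hf)
  obtain ⟨β, hβ⟩ := hf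
  let β' : G → M := Function.extend θ β 0
  have hβ' : ∀ k, β' (θ k) = β k := fun k => hθ.extend_apply _ _ _
  suffices ∀ f ∈ Z2 ρ, (∀ k l, f (θ k) (θ l) = 0) → f ∈ B2 ρ by
    have h1 := this (f.1 - d1 ρ β') (sub_mem f.2 (B2_le_Z2 ρ ⟨_, rfl⟩)) fun k l => by
      have := congrFun (congrFun hβ k) l
      rw [Pi.sub_apply, Pi.sub_apply, sub_eq_zero, d1_apply, ← map_mul, hβ', hβ', hβ']
      exact this.symm
    have h2 := add_mem h1 (⟨β', rfl⟩ : d1 ρ β' ∈ B2 ρ)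
    rwa [sub_add_cancel] at h2
  clear! f
  intro f hf h0
  suffices ∀ f ∈ Z2 ρ, (∀ g k, f g (θ k) = 0) → f ∈ B2 ρ by
    let t : G → G := fun g => (QuotientGroup.mk g : G ⧸ θ.range).out
    have htk : ∀ g k, t (g * θ k) = t g := fun g k =>
      congrArg Quotient.out (QuotientGroup.mk_mul_of_mem g ⟨k, rfl⟩)
    have htg : ∀ g, ∃ k, θ k = (t g)⁻¹ * g := fun g =>
      QuotientGroup.eq.1 (QuotientGroup.out_eq' (QuotientGroup.mk g : G ⧸ θ.range))
    let γ : G → M := fun g => f (t g) ((t g)⁻¹ * g)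
    have h1 := this (f + d1 ρ γ) (add_mem hf (B2_le_Z2 ρ ⟨_, rfl⟩)) fun g k => by
      obtain ⟨u, hu⟩ := htg g
      obtain ⟨s, hs⟩ := htg (θ k)
      have hs' : t (θ k) = θ (k * s⁻¹) := by
        rw [map_mul, map_inv, hs]
        group
      have e1 : γ (θ k) = 0 := by
        simp only [γ]
        rw [← hs, hs', h0]
      have e2 := hf (t g) (θ u) (θ k)
      rw [h0, map_zero, hu, mul_inv_cancel_left] at e2
      rw [Pi.add_apply, Pi.add_apply, d1_apply, e1, map_zero]
      simp only [γ, htk, ← mul_assoc]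
      linear_combination (norm := abel) -e2
    have h2 := sub_mem h1 (⟨γ, rfl⟩ : d1 ρ γ ∈ B2 ρ)
    rwa [add_sub_cancel_right] at h2
  clear! f
  intro f hf h0
  have hk : ∀ g h k, f g (h * θ k) = f g h := by
    intro g h k
    have := hf g h (θ k)
    rw [h0, h0, map_zero] at this
    linear_combination (norm := abel) this
  have hrep : ∀ g h h', (QuotientGroup.mk h : G ⧸ θ.range) = QuotientGroup.mk h' →
      f g h = f g h' := by
    intro g h h' e
    obtain ⟨k, hk'⟩ := QuotientGroup.eq.1 e
    rw [← hk g h k, hk', mul_inv_cancel_left]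
  refine ⟨fun g => ∑ ω : G ⧸ θ.range, f g ω.out, ?_⟩
  funext g h
  have e1 : ∀ ω : G ⧸ θ.range, ρ g (f h ω.out) - f (g * h) ω.out =
      f g h - f g ((h • ω : G ⧸ θ.range).out) := by
    intro ω
    have := hf g h ω.out
    rw [hrep g (h • ω).out (h * ω.out) (by
      rw [QuotientGroup.out_eq']
      nth_rewrite 1 [← QuotientGroup.out_eq' ω]
      rfl)]
    linear_combination (norm := abel) this
  have e2 := Finset.sum_congr rfl fun ω (_ : ω ∈ Finset.univ) => e1 ω
  have e3 : ∑ ω : G ⧸ θ.range, f g ((h • ω : G ⧸ θ.range).out) =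
      ∑ ω : G ⧸ θ.range, f g ω.out :=
    Fintype.sum_equiv (MulAction.toPerm h) _ _ fun _ => rfl
  have hcard : Odd (Fintype.card (G ⧸ θ.range)) := by
    rwa [← Nat.card_eq_fintype_card]
  simp only [Finset.sum_sub_distrib, Finset.sum_const, Finset.card_univ, odd_nsmul F hcard,
    e3] at e2
  rw [d1_apply, map_sum, e2]
  abel

end Functoriality

section Embedding

variable {α Ω : Type*} [DecidableEq α] [Fintype α] [DecidableEq Ω] [Fintype Ω]

theorem sign_viaEmbedding (ι : α ↪ Ω) (σ : Perm α) :
    Perm.sign (Perm.viaEmbeddingHom ι σ) = Perm.sign σ := by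
  classical
  rw [Perm.viaEmbeddingHom_apply, Perm.viaEmbedding]
  convert Perm.sign_extendDomain σ (Equiv.ofInjective ι ι.injective) <;> rfl

/-- The embedding of alternating groups attached to an embedding of sets. -/
noncomputable def altEmb (ι : α ↪ Ω) : alternatingGroup α →* alternatingGroup Ω :=
  ((Perm.viaEmbeddingHom ι).comp (alternatingGroup α).subtype).codRestrict _ fun σ => by
    rw [Perm.mem_alternatingGroup, MonoidHom.comp_apply, sign_viaEmbedding]
    exact σ.2

theorem coe_altEmb (ι : α ↪ Ω) (σ : alternatingGroup α) :
    (altEmb ι σ : Perm Ω) = Perm.viaEmbedding (σ : Perm α) ι := rfl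

@[simp] theorem altEmb_apply (ι : α ↪ Ω) (σ : alternatingGroup α) (i : α) :
    (altEmb ι σ : Perm Ω) (ι i) = ι ((σ : Perm α) i) :=
  Perm.viaEmbedding_apply _ ι i

theorem altEmb_apply_of_notMem (ι : α ↪ Ω) (σ : alternatingGroup α) {i : Ω}
    (hi : i ∉ Set.range ι) : (altEmb ι σ : Perm Ω) i = i :=
  Perm.viaEmbedding_apply_of_notMem _ ι i hi

theorem altEmb_injective (ι : α ↪ Ω) : Function.Injective (altEmb ι) := by
  intro σ τ h
  exact Subtype.ext (Perm.viaEmbeddingHom_injective ι (congrArg Subtype.val h))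

theorem map_swap_of_injective {α Ω : Type*} [DecidableEq α] [DecidableEq Ω] (ι : α ↪ Ω)
    (i j k : α) :
    ι (swap i j k) = swap (ι i) (ι j) (ι k) := by
  simp only [swap_apply_def, ι.injective.eq_iff]
  split_ifs <;> rfl

theorem altEmb_xA (ι : α ↪ Ω) (a b j : α) : altEmb ι (xA a b j) = xA (ι a) (ι b) (ι j) := by
  refine Subtype.ext (Equiv.ext fun i => ?_)
  by_cases hi : i ∈ Set.range ι
  · obtain ⟨i, rfl⟩ := hi
    rw [altEmb_apply]
    simp [cyc, map_swap_of_injective]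
  · rw [altEmb_apply_of_notMem ι _ hi]
    have h : ∀ x, i ≠ ι x := fun x hx => hi ⟨x, hx.symm⟩
    simp [cyc, swap_apply_of_ne_of_ne (h _) (h _)]

theorem index_altEmb (ι : α ↪ Ω) [Nontrivial α] :
    (Fintype.card α).factorial * (altEmb ι).range.index = (Fintype.card Ω).factorial := by
  have : Nontrivial Ω := ι.injective.nontrivial
  have h1 := (altEmb ι).range.card_mul_index
  rw [Nat.card_congr (MonoidHom.ofInjective (altEmb_injective ι)).symm.toEquiv] at h1
  have h2 := two_mul_nat_card_alternatingGroup (α := α)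
  have h3 := two_mul_nat_card_alternatingGroup (α := Ω)
  rw [Nat.card_perm] at h2 h3
  rw [← Nat.card_eq_fintype_card, ← Nat.card_eq_fintype_card, ← h2, ← h3, mul_assoc, h1]

end Embedding

/-- The bound on second cohomology for all modules over the alternating group of `Ω`. -/
def BoundOn (Ω : Type) [DecidableEq Ω] [Fintype Ω] : Prop :=
  ∀ (F : Type) [Field F] [CharP F 2] (M : Type) [AddCommGroup M] [Module F M]
    [FiniteDimensional F M] (ρ : Representation F (alternatingGroup Ω) M),
    12 * h2 ρ ≤ 35 * Module.finrank F M

section Reduction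

variable {α Ω : Type} [DecidableEq α] [Fintype α] [DecidableEq Ω] [Fintype Ω]

theorem BoundOn.of_card_eq [Nontrivial α] (h : BoundOn α) (hc : Fintype.card α = Fintype.card Ω) :
    BoundOn Ω := by
  intro F _ _ M _ _ _ ρ
  let ι : α ↪ Ω := (Fintype.equivOfCardEq hc).toEmbedding
  refine (Nat.mul_le_mul_left 12 (h2_le_comp_of_odd_index ρ (altEmb ι) (altEmb_injective ι) ?_)).trans
    (h F M _)
  have := index_altEmb ι
  rw [hc, Nat.mul_eq_left (Nat.factorial_ne_zero _)] at this
  simp [this]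

theorem BoundOn.of_card_add_one [Nontrivial α] (h : BoundOn α)
    (hc : Fintype.card α + 1 = Fintype.card Ω) (hodd : Odd (Fintype.card Ω)) : BoundOn Ω := by
  intro F _ _ M _ _ _ ρ
  obtain ⟨ι⟩ : Nonempty (α ↪ Ω) := Function.Embedding.nonempty_of_card_le (by omega)
  refine (Nat.mul_le_mul_left 12 (h2_le_comp_of_odd_index ρ (altEmb ι) (altEmb_injective ι) ?_)).trans
    (h F M _)
  have := index_altEmb ι
  rw [← hc, Nat.factorial_succ, mul_comm (_ + 1)] at this
  rwa [Nat.eq_of_mul_eq_mul_left (Nat.factorial_pos _) this, hc]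

theorem boundOn_of_invariants {a b p q : Ω} (hab : a ≠ b) (hpa : p ≠ a) (hpb : p ≠ b)
    (hqa : q ≠ a) (hqb : q ≠ b) (hpq : p ≠ q)
    (h : ∀ (F : Type) [Field F] [CharP F 2] (M : Type) [AddCommGroup M] [Module F M]
      [FiniteDimensional F M] (ρ : Representation F (alternatingGroup Ω) M),
      (∀ m, (∀ g, ρ g m = m) → m = 0) → 12 * h2 ρ ≤ 35 * Module.finrank F M) : BoundOn Ω := by
  intro F _ _ M _ _ _ ρ
  let W : Submodule F M := ρ.invariants
  have hW : ∀ g, W ≤ W.comap (ρ g) := fun g m hm => by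
    rw [Submodule.mem_comap, hm g]
    exact hm
  have h1 := h2_le_add ρ W hW
  have h2 := h2_le_of_trivial (ρ.subrepresentation W hW) (fun g m => Subtype.ext (m.2 g))
    hab hpa hpb hqa hqb hpq
  have h3 := h F (M ⧸ W) (ρ.quotient W hW) fun m hm => by
    obtain ⟨m, rfl⟩ := W.mkQ_surjective m
    rw [Submodule.mkQ_apply, Submodule.Quotient.mk_eq_zero]
    have hm' : ∀ g, ρ g m - m ∈ W := fun g => by
      rw [← Submodule.Quotient.mk_eq_zero, Submodule.Quotient.mk_sub, sub_eq_zero]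
      exact hm g
    let S : Subgroup (alternatingGroup Ω) :=
      { carrier := {g | ρ g m = m}
        one_mem' := by simp
        mul_mem' := fun {x y} (hx : ρ x m = m) (hy : ρ y m = m) => by
          change ρ (x * y) m = m
          rw [map_mul, Module.End.mul_apply, hy, hx]
        inv_mem' := fun {x} (hx : ρ x m = m) => by
          change ρ x⁻¹ m = m
          nth_rewrite 1 [← hx]
          simp }
    have : S = ⊤ := eq_top_of_xA_mem hab S fun j _ _ => by
      change ρ (xA a b j) m = m
      set x := xA a b j
      obtain ⟨t, ht⟩ : ∃ t, t = ρ x m - m := ⟨_, rfl⟩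
      have htx : ρ x t = t := (ht ▸ hm' x : t ∈ W) x
      have hx : ρ x m = m + t := by rw [ht]; abel
      have h3 : ρ (x ^ 3) m = m := by simp [x, xA_pow_three hab]
      rw [pow_succ, sq, map_mul, map_mul, Module.End.mul_apply, Module.End.mul_apply, hx, map_add,
        hx, htx, map_add, map_add, hx, htx, add_assoc, add_self_eq_zero F, add_zero] at h3
      rw [hx, h3]
    intro g
    have hg : g ∈ S := this ▸ Subgroup.mem_top g
    exact hg
  have h4 := Submodule.finrank_quotient_add_finrank W
  change 12 * AltH2.h2 ρ ≤ _
  omega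

end Reduction

section Fixed

variable {F G M : Type*} [Field F] [Group G] [AddCommGroup M] [Module F M]
  (ρ : Representation F G M)

/-- The vectors fixed by a group element. -/
def fix (g : G) : Submodule F M := LinearMap.eqLocus (ρ g) LinearMap.id

variable {ρ}

theorem mem_fix {g : G} {m : M} : m ∈ fix ρ g ↔ ρ g m = m := Iff.rfl

variable (ρ) in
/-- The stabilizer of a vector. -/
def stab (m : M) : Subgroup G where
  carrier := {g | ρ g m = m}
  one_mem' := by simp
  mul_mem' := fun {x y} (hx : ρ x m = m) (hy : ρ y m = m) => by
    change ρ (x * y) m = m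
    rw [map_mul, Module.End.mul_apply, hy, hx]
  inv_mem' := fun {x} (hx : ρ x m = m) => by
    change ρ x⁻¹ m = m
    nth_rewrite 1 [← hx]
    simp

theorem mem_stab {g : G} {m : M} : g ∈ stab ρ m ↔ ρ g m = m := Iff.rfl

theorem finrank_fix_conj [FiniteDimensional F M] (g h : G) :
    Module.finrank F (fix ρ (h * g * h⁻¹)) = Module.finrank F (fix ρ g) := by
  have key : ∀ g h : G, Module.finrank F (fix ρ (h * g * h⁻¹)) ≤ Module.finrank F (fix ρ g) := by
    intro g h
    refine LinearMap.finrank_le_finrank_of_injective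
      (f := (ρ h⁻¹).restrict (p := fix ρ (h * g * h⁻¹)) (q := fix ρ g) fun m hm => ?_) ?_
    · rw [mem_fix] at hm ⊢
      nth_rewrite 2 [← hm]
      simp [← Module.End.mul_apply, ← map_mul, mul_assoc]
    · intro m m' h'
      exact Subtype.ext ((ρ.apply_bijective h⁻¹).1 (congrArg Subtype.val h'))
  refine le_antisymm (key g h) ?_
  have := key (h * g * h⁻¹) h⁻¹
  rwa [show h⁻¹ * (h * g * h⁻¹) * h⁻¹⁻¹ = g by group] at this

theorem finrank_le_sum_of_inf [FiniteDimensional F M] {ι : Type*} [Fintype ι]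
    (V : Submodule F M) (W : ι → Submodule F M) (h : ∀ m ∈ V, (∀ i, m ∈ W i) → m = 0) :
    Module.finrank F V ≤ ∑ i, (Module.finrank F M - Module.finrank F (W i)) := by
  have h1 : ∀ i, Module.finrank F M - Module.finrank F (W i) = Module.finrank F (M ⧸ W i) :=
    fun i => by rw [← Submodule.finrank_quotient_add_finrank (W i), Nat.add_sub_cancel]
  simp only [h1]
  rw [← Module.finrank_pi_fintype]
  refine LinearMap.finrank_le_finrank_of_injective
    (f := (LinearMap.pi fun i => (W i).mkQ).domRestrict V) ?_
  rw [← LinearMap.ker_eq_bot, eq_bot_iff]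
  intro m hm
  refine (Submodule.mem_bot F).2 (Subtype.ext (h m m.2 fun i => ?_))
  rw [← Submodule.Quotient.mk_eq_zero]
  exact congrFun hm i

end Fixed

section OddGroups

variable {Ω R : Type*} [DecidableEq Ω] [Fintype Ω] [Group R]

/-- An action of a group of odd order is by even permutations. -/
def altOfOdd (hR : Odd (Nat.card R)) (ψ : R →* Perm Ω) : R →* alternatingGroup Ω :=
  ψ.codRestrict _ fun r => by
    rw [Perm.mem_alternatingGroup]
    have h1 : Perm.sign (ψ r) ^ Nat.card R = 1 := by
      rw [← map_pow, ← map_pow, pow_card_eq_one', map_one, map_one]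
    obtain ⟨k, hk⟩ := hR
    rwa [hk, pow_succ, pow_mul, Int.units_sq, one_pow, one_mul] at h1

@[simp] theorem coe_altOfOdd (hR : Odd (Nat.card R)) (ψ : R →* Perm Ω) (r : R) :
    (altOfOdd hR ψ r : Perm Ω) = ψ r := rfl

/-- The translation action of `ZMod m` on itself. -/
abbrev transl (m : ℕ) : Multiplicative (ZMod m) →* Perm (ZMod m) := MulAction.toPermHom _ _

theorem card_mul_zmod (m : ℕ) : Nat.card (Multiplicative (ZMod m)) = m := by
  rw [Nat.card_congr Multiplicative.toAdd, Nat.card_zmod]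

end OddGroups

section SmallDegree

set_option synthInstance.maxHeartbeats 200000 in
set_option synthInstance.maxSize 2000 in
set_option maxRecDepth 10000 in
theorem boundOn_five : BoundOn (ZMod 3 ⊕ Fin 2) := by
  intro F _ _ M _ _ _ ρ
  let ψ : Multiplicative (ZMod 3) →* Perm (ZMod 3 ⊕ Fin 2) :=
    (Perm.sumCongrHom _ _).comp ((transl 3).prod 1)
  have hR : Odd (Nat.card (Multiplicative (ZMod 3))) := by rw [card_mul_zmod]; decide
  have := h2_le_sum hR ρ (altOfOdd hR ψ) (a := Sum.inr 0) (b := Sum.inr 1) (by decide)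
    (fun _ => rfl) (fun _ => rfl) (ι := Unit) (fun _ => (Sum.inl 0, Sum.inl 1)) (fun _ => ⊤)
    (by simp only [coe_altOfOdd]; decide) (fun _ _ => Submodule.mem_top)
  simp only [Finset.univ_unique, Finset.sum_const, Finset.card_singleton, one_smul, finrank_top]
    at this
  omega

set_option synthInstance.maxHeartbeats 200000 in
set_option synthInstance.maxSize 2000 in
set_option maxRecDepth 10000 in
theorem boundOn_six : BoundOn ((ZMod 3 ⊕ Unit) ⊕ Fin 2) := by
  intro F _ _ M _ _ _ ρ
  let ψ : Multiplicative (ZMod 3) →* Perm ((ZMod 3 ⊕ Unit) ⊕ Fin 2) :=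
    (Perm.sumCongrHom _ _).comp (((Perm.sumCongrHom _ _).comp ((transl 3).prod 1)).prod 1)
  have hR : Odd (Nat.card (Multiplicative (ZMod 3))) := by rw [card_mul_zmod]; decide
  have := h2_le_sum hR ρ (altOfOdd hR ψ) (a := Sum.inr 0) (b := Sum.inr 1) (by decide)
    (fun _ => rfl) (fun _ => rfl) (ι := Fin 2)
    ![(Sum.inl (Sum.inl 0), Sum.inl (Sum.inl 1)), (Sum.inl (Sum.inl 0), Sum.inl (Sum.inr ()))]
    (fun _ => ⊤) (by simp only [coe_altOfOdd]; decide) (fun _ _ => Submodule.mem_top)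
  simp only [Fin.sum_univ_two, finrank_top] at this
  omega

theorem isThreeCycle_cyc {Ω : Type*} [DecidableEq Ω] [Fintype Ω] {a b j : Ω} (hja : j ≠ a)
    (hjb : j ≠ b) (hab : a ≠ b) : (cyc a b j).IsThreeCycle :=
  (Perm.isThreeCycle_swap_mul_swap_same hab hja.symm hjb.symm).isThreeCycle_sq

theorem finrank_fix_threeCycle {Ω F M : Type*} [DecidableEq Ω] [Fintype Ω] [Field F]
    [AddCommGroup M] [Module F M] [FiniteDimensional F M]
    {ρ : Representation F (alternatingGroup Ω) M} (h5 : 5 ≤ Fintype.card Ω)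
    (hρ : ∀ m, (∀ g, ρ g m = m) → m = 0) {a b j : Ω} (hab : a ≠ b) (hja : j ≠ a) (hjb : j ≠ b) :
    Module.finrank F M ≤ (Fintype.card Ω - 2) *
      (Module.finrank F M - Module.finrank F (fix ρ (xA a b j))) := by
  have h1 := finrank_le_sum_of_inf ⊤ (fun i : {i : Ω // i ∉ ({a, b} : Finset Ω)} =>
    fix ρ (xA a b i.1)) fun m _ hm => hρ m fun g => by
      have hS := eq_top_of_xA_mem hab (stab ρ m) fun j hja hjb => hm ⟨j, by simp [hja, hjb]⟩
      exact mem_stab.1 (hS ▸ Subgroup.mem_top g)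
  have h2 : ∀ i : {i : Ω // i ∉ ({a, b} : Finset Ω)},
      Module.finrank F (fix ρ (xA a b i.1)) = Module.finrank F (fix ρ (xA a b j)) := by
    rintro ⟨i, hi⟩
    simp only [Finset.mem_insert, Finset.mem_singleton, not_or] at hi
    obtain ⟨c, hc⟩ := isConj_iff.1 (alternatingGroup.isThreeCycle_isConj
      (by rwa [Nat.card_eq_fintype_card])
      (isThreeCycle_cyc hja hjb hab) (isThreeCycle_cyc hi.1 hi.2 hab) :
        IsConj (xA a b j) (xA a b i))
    rw [← hc, finrank_fix_conj]
  simp only [h2, Finset.sum_const, Finset.card_univ, smul_eq_mul] at h1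
  have h3 : Fintype.card {i : Ω // i ∉ ({a, b} : Finset Ω)} = Fintype.card Ω - 2 := by
    rw [Fintype.card_subtype_compl, Fintype.card_coe, Finset.card_pair hab]
  rwa [h3, finrank_top] at h1

set_option synthInstance.maxHeartbeats 200000 in
set_option synthInstance.maxSize 2000 in
set_option maxRecDepth 10000 in
theorem boundOn_eight : BoundOn ((ZMod 3 ⊕ ZMod 3) ⊕ Fin 2) := by
  refine boundOn_of_invariants (a := Sum.inr 0) (b := Sum.inr 1) (p := Sum.inl (Sum.inl 0))
    (q := Sum.inl (Sum.inl 1)) (by decide) (by decide) (by decide) (by decide) (by decide)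
    (by decide) ?_
  intro F _ _ M _ _ _ ρ hρ
  let ψ : Multiplicative (ZMod 3) × Multiplicative (ZMod 3) →* Perm ((ZMod 3 ⊕ ZMod 3) ⊕ Fin 2) :=
    (Perm.sumCongrHom _ _).comp
      (((Perm.sumCongrHom _ _).comp ((transl 3).prodMap (transl 3))).prod 1)
  have hR : Odd (Nat.card (Multiplicative (ZMod 3) × Multiplicative (ZMod 3))) := by
    rw [Nat.card_prod, card_mul_zmod]; decide
  have := h2_le_sum hR ρ (altOfOdd hR ψ) (a := Sum.inr 0) (b := Sum.inr 1) (by decide)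
    (fun _ => rfl) (fun _ => rfl) (ι := Fin 3)
    ![(Sum.inl (Sum.inl 0), Sum.inl (Sum.inl 1)), (Sum.inl (Sum.inr 0), Sum.inl (Sum.inr 1)),
      (Sum.inl (Sum.inl 0), Sum.inl (Sum.inr 0))]
    ![fix ρ (xA (Sum.inl (Sum.inr 1)) (Sum.inl (Sum.inr 2)) (Sum.inl (Sum.inr 0))),
      fix ρ (xA (Sum.inl (Sum.inl 1)) (Sum.inl (Sum.inl 2)) (Sum.inl (Sum.inl 0))), ⊤]
    (by simp only [coe_altOfOdd]; decide) ?_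
  · have h0 := finrank_fix_threeCycle (ρ := ρ) (by decide) hρ
      (a := Sum.inl (Sum.inr 1)) (b := Sum.inl (Sum.inr 2)) (j := Sum.inl (Sum.inr 0))
      (by decide) (by decide) (by decide)
    have h1 := finrank_fix_threeCycle (ρ := ρ) (by decide) hρ
      (a := Sum.inl (Sum.inl 1)) (b := Sum.inl (Sum.inl 2)) (j := Sum.inl (Sum.inl 0))
      (by decide) (by decide) (by decide)
    rw [show Fintype.card ((ZMod 3 ⊕ ZMod 3) ⊕ Fin 2) = 8 by decide] at h0 h1
    have arith : ∀ d x y z t : ℕ, d ≤ (8 - 2) * (d - x) → d ≤ (8 - 2) * (d - y) → x ≤ d → y ≤ d →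
        z = d → t ≤ x + y + z → 12 * t ≤ 35 * d := by omega
    exact arith _ _ _ _ _ h0 h1 (Submodule.finrank_le _) (Submodule.finrank_le _) (finrank_top F M)
      (this.trans_eq (Fin.sum_univ_three _))
  · intro k f
    fin_cases k
    · have h := rel_conj f (xA (Sum.inr 0) (Sum.inr 1) (Sum.inl (Sum.inl 0)))
        (xA (Sum.inr 0) (Sum.inr 1) (Sum.inl (Sum.inl 1))) (1, Multiplicative.ofAdd 1)
      rw [conj_xA, conj_xA] at h
      rw [show xA (Sum.inl (Sum.inr 1)) (Sum.inl (Sum.inr 2)) (Sum.inl (Sum.inr 0)) =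
        altOfOdd hR ψ (1, Multiplicative.ofAdd 1) from
        Subtype.ext (by rw [coe_altOfOdd]; decide)]
      exact h.symm
    · have h := rel_conj f (xA (Sum.inr 0) (Sum.inr 1) (Sum.inl (Sum.inr 0)))
        (xA (Sum.inr 0) (Sum.inr 1) (Sum.inl (Sum.inr 1))) (Multiplicative.ofAdd 1, 1)
      rw [conj_xA, conj_xA] at h
      rw [show xA (Sum.inl (Sum.inl 1)) (Sum.inl (Sum.inl 2)) (Sum.inl (Sum.inl 0)) =
        altOfOdd hR ψ (Multiplicative.ofAdd 1, 1) from
        Subtype.ext (by rw [coe_altOfOdd]; decide)]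
      exact h.symm
    · exact Submodule.mem_top

end SmallDegree

section Frobenius

variable {F G M : Type*} [Field F] [Group G] [AddCommGroup M] [Module F M]

/-- If `p` and `v` generate a Frobenius group of order `21`, then `p` has few fixed vectors that
are not fixed by `v`. -/
theorem finrank_fix_frobenius [CharP F 2] [FiniteDimensional F M] (ρ : Representation F G M)
    {p v : G} (hpv : p * v = v ^ 2 * p) (hv : v ^ 7 = 1) :
    3 * Module.finrank F (fix ρ p) ≤ Module.finrank F M +
      2 * Module.finrank F ((fix ρ v).comap (fix ρ p).subtype) := by
  set P := fix ρ p
  set N := (fix ρ v).comap P.subtype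
  have hv8 : v ^ 8 = v := by rw [pow_succ, hv, one_mul]
  have hact : ∀ x : M, ρ p x = x → ∀ k, ρ p (ρ (v ^ k) x) = ρ (v ^ (2 * k)) x := by
    intro x hx k
    have h : p * v ^ k = v ^ (2 * k) * p := by
      rw [pow_mul]
      exact SemiconjBy.pow_right hpv k
    rw [← Module.End.mul_apply, ← map_mul, h, map_mul, Module.End.mul_apply, hx]
  have hsum : ∀ x : M, ρ (v ^ 5) x + ρ (v ^ 6) x + ρ (v ^ 3) x =
      ρ (v ^ 2) x + ρ (v ^ 4) x + ρ (v ^ 1) x → ρ v x = x := by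
    intro x hx
    have h1 := congrArg (ρ v) hx
    simp only [map_add, ← Module.End.mul_apply, ← map_mul, ← pow_succ', hv, map_one,
      Module.End.one_apply, Nat.reduceAdd] at h1
    rw [pow_one] at hx
    have h2 := add_self_eq_zero F (ρ (v ^ 2) x)
    have h7 := add_self_eq_zero F (ρ (v ^ 6) x)
    linear_combination (norm := module) h7 - h2 - h1 - hx
  let Ψ : P × P × P →ₗ[F] M := P.subtype.coprod
    (((ρ v - 1) ∘ₗ P.subtype).coprod ((ρ (v ^ 2) - 1) ∘ₗ P.subtype))
  have hΨ : ∀ x, Ψ x = x.1.1 + ((ρ v x.2.1.1 - x.2.1.1) + (ρ (v ^ 2) x.2.2.1 - x.2.2.1)) :=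
    fun _ => rfl
  have key : ∀ x, Ψ x = 0 → x.2.1 ∈ N ∧ x.2.2 ∈ N := by
    rintro ⟨⟨x, hx⟩, ⟨y, hy⟩, ⟨z, hz⟩⟩ h
    rw [hΨ] at h
    dsimp only at h
    have e0 : x + ((ρ (v ^ 1) y - y) + (ρ (v ^ 2) z - z)) = 0 := by rwa [pow_one]
    have e1 := congrArg (ρ p) e0
    simp only [map_add, map_sub, hact y hy, hact z hz, mem_fix.1 hx, mem_fix.1 hy, mem_fix.1 hz,
      map_zero] at e1
    have e2 := congrArg (ρ p) e1
    simp only [map_add, map_sub, hact y hy, hact z hz, mem_fix.1 hx, mem_fix.1 hy, mem_fix.1 hz,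
      map_zero] at e2
    simp only [Nat.reduceMul, hv8] at e1 e2
    have f1 : ∀ k, ρ (v ^ (k + 1)) y - ρ (v ^ (k + 2)) y + (ρ (v ^ (k + 2)) z - ρ (v ^ (k + 4)) z)
        = 0 := by
      intro k
      have := congrArg (ρ (v ^ k)) (e0.trans e1.symm)
      simp only [map_add, map_sub, ← Module.End.mul_apply, ← map_mul, ← pow_add] at this
      linear_combination (norm := module) this
    have f2 : ∀ k, ρ (v ^ (k + 2)) y - ρ (v ^ (k + 4)) y + (ρ (v ^ (k + 4)) z - ρ (v ^ (k + 1)) z)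
        = 0 := by
      intro k
      have := congrArg (ρ (v ^ k)) (e1.trans e2.symm)
      simp only [map_add, map_sub, ← Module.End.mul_apply, ← map_mul, ← pow_add, ← pow_succ] at this
      linear_combination (norm := module) this
    have g1 := f1 1
    have g2 := f1 2
    have g4 := f1 4
    have k1 := f2 1
    have k2 := f2 2
    have k4 := f2 4
    simp only [Nat.reduceAdd, hv8] at g1 g2 g4 k1 k2 k4
    constructor
    · refine hsum y ?_
      rw [pow_one]
      linear_combination (norm := module) g4 - g1 - k2 + k4
    · refine hsum z ?_
      rw [pow_one]
      linear_combination (norm := module) g4 - g2 + k1 - k2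
  have hker : Module.finrank F (LinearMap.ker Ψ) ≤ Module.finrank F (N × N) := by
    refine LinearMap.finrank_le_finrank_of_injective
      (f := ((LinearMap.fst F P P ∘ₗ LinearMap.snd F P (P × P)).restrict
        (p := LinearMap.ker Ψ) (q := N) fun x hx => (key x hx).1).prod
        ((LinearMap.snd F P P ∘ₗ LinearMap.snd F P (P × P)).restrict
        (p := LinearMap.ker Ψ) (q := N) fun x hx => (key x hx).2)) ?_
    rw [← LinearMap.ker_eq_bot, eq_bot_iff]
    rintro ⟨⟨x, y, z⟩, hx⟩ h
    have hy : y = 0 := congrArg (fun w => w.1.1) h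
    have hz : z = 0 := congrArg (fun w => w.2.1) h
    subst hy hz
    have hx' : Ψ (x, 0, 0) = 0 := hx
    rw [hΨ] at hx'
    have hx0 : x = 0 := Subtype.ext (by simpa using hx')
    subst hx0
    rfl
  have h1 := LinearMap.finrank_range_add_finrank_ker Ψ
  have h2 := Submodule.finrank_le (LinearMap.range Ψ)
  simp only [Module.finrank_prod] at h1 hker
  omega

end Frobenius

section Affine

/-- The affine maps of the field with seven elements whose slope is a square. -/
def aff : Subgroup (Perm (ZMod 7)) where
  carrier := {σ | ∃ c s : ZMod 7, c ^ 3 = 1 ∧ ∀ x, σ x = c * x + s}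
  one_mem' := ⟨1, 0, by simp⟩
  mul_mem' := by
    rintro σ τ ⟨c, s, hc, hσ⟩ ⟨d, t, hd, hτ⟩
    exact ⟨c * d, c * t + s, by rw [mul_pow, hc, hd, one_mul], fun x => by
      rw [Perm.mul_apply, hτ, hσ]; ring⟩
  inv_mem' := by
    rintro σ ⟨c, s, hc, hσ⟩
    refine ⟨c ^ 2, - c ^ 2 * s, by rw [← pow_mul, mul_comm, pow_mul, hc, one_pow], fun x => ?_⟩
    rw [Perm.inv_eq_iff_eq, hσ]
    linear_combination -(x - s) * hc

/-- The affine map `x ↦ c * x + s`. -/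
def affMk (c s : ZMod 7) (hc : c ^ 3 = 1) : aff :=
  ⟨⟨fun x => c * x + s, fun x => c ^ 2 * (x - s), fun x => by linear_combination x * hc,
    fun x => by linear_combination (x - s) * hc⟩, c, s, hc, fun _ => rfl⟩

@[simp] theorem affMk_apply (c s : ZMod 7) (hc : c ^ 3 = 1) (x : ZMod 7) :
    (affMk c s hc : Perm (ZMod 7)) x = c * x + s := rfl

theorem aff_eq_affMk (h : aff) : ∃ c s, ∃ hc : c ^ 3 = 1, h = affMk c s hc := by
  obtain ⟨σ, c, s, hc, hσ⟩ := h
  exact ⟨c, s, hc, Subtype.ext (Equiv.ext hσ)⟩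

/-- Translations. -/
abbrev affT (s : ZMod 7) : aff := affMk 1 s (one_pow 3)

/-- Multiplication by two. -/
abbrev affP : aff := affMk 2 0 (by decide)

theorem affP_mul_affT : affP * affT 1 = affT 1 ^ 2 * affP := Subtype.ext (Equiv.ext (by decide))

theorem affT_pow_seven : affT 1 ^ 7 = 1 := Subtype.ext (Equiv.ext (by decide))

theorem odd_card_aff : Odd (Nat.card aff) := by
  by_contra h
  rw [Nat.not_odd_iff_even, even_iff_two_dvd] at h
  obtain ⟨h, hh⟩ := exists_prime_orderOf_dvd_card' 2 h
  obtain ⟨c, s, hc, rfl⟩ := aff_eq_affMk h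
  have h2 := pow_orderOf_eq_one (affMk c s hc)
  rw [hh] at h2
  have h3 : ∀ x, c * (c * x + s) + s = x := fun x => by
    simpa [sq] using congrArg (fun σ : aff => (σ : Perm (ZMod 7)) x) h2
  have key : ∀ c s : ZMod 7, c ^ 3 = 1 → (∀ x, c * (c * x + s) + s = x) → c = 1 ∧ s = 0 := by
    decide
  obtain ⟨rfl, rfl⟩ := key c s hc h3
  have h1 : affMk 1 0 hc = 1 := Subtype.ext (Equiv.ext fun x => by simp)
  rw [h1, orderOf_one] at hh
  omega

variable {F M : Type*} [Field F] [AddCommGroup M] [Module F M] {τ : Representation F aff M} {x : M}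

theorem affMk_zero_fix (hp : τ affP x = x) (c : ZMod 7) (hc : c ^ 3 = 1) :
    τ (affMk c 0 hc) x = x := by
  have key : ∀ c : ZMod 7, c ^ 3 = 1 → c = 1 ∨ c = 2 ∨ c = 4 := by decide
  obtain rfl | rfl | rfl := key c hc
  · rw [show affMk 1 0 hc = 1 from Subtype.ext (Equiv.ext (by decide +revert)), map_one]
    rfl
  · exact hp
  · rw [show affMk 4 0 hc = affP * affP from Subtype.ext (Equiv.ext (by decide +revert)), map_mul,
      Module.End.mul_apply, hp, hp]

theorem affT_fix (hv : τ (affT 1) x = x) (s : ZMod 7) : τ (affT s) x = x := by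
  have key : ∀ k : ℕ, τ (affT k) x = x := by
    intro k
    induction k with
    | zero =>
      rw [show affT (0 : ℕ) = 1 from Subtype.ext (Equiv.ext fun y => by simp), map_one]
      rfl
    | succ k ih =>
      rw [show affT (k + 1 : ℕ) = affT 1 * affT k from Subtype.ext (Equiv.ext fun y => by
        simp; ring), map_mul, Module.End.mul_apply, ih, hv]
  simpa using key s.val

theorem affMk_eq_mul (c s : ZMod 7) (hc : c ^ 3 = 1) : affMk c s hc = affT s * affMk c 0 hc :=
  Subtype.ext (Equiv.ext fun y => by simp)

theorem aff_fix (hp : τ affP x = x) (hv : τ (affT 1) x = x) (h : aff) : τ h x = x := by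
  obtain ⟨c, s, hc, rfl⟩ := aff_eq_affMk h
  rw [affMk_eq_mul, map_mul, Module.End.mul_apply, affMk_zero_fix hp, affT_fix hv]

end Affine

section Points

/-- The points on which the alternating group acts. -/
abbrev Pts (m : ℕ) := (ZMod 7 ⊕ Fin 2) ⊕ ZMod m

variable (m : ℕ)

/-- The action of the affine group and of the translations on the points. -/
def ptsHom : aff × Multiplicative (ZMod m) →* Perm (Pts m) :=
  (Perm.sumCongrHom _ _).comp
    (((Perm.sumCongrHom _ _).comp (aff.subtype.prod 1)).prodMap (transl m))

variable {m}

@[simp] theorem ptsHom_inl_inl (r : aff × Multiplicative (ZMod m)) (i : ZMod 7) :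
    ptsHom m r (Sum.inl (Sum.inl i)) = Sum.inl (Sum.inl ((r.1 : Perm (ZMod 7)) i)) := rfl

@[simp] theorem ptsHom_inl_inr (r : aff × Multiplicative (ZMod m)) (i : Fin 2) :
    ptsHom m r (Sum.inl (Sum.inr i)) = Sum.inl (Sum.inr i) := rfl

@[simp] theorem ptsHom_inr (r : aff × Multiplicative (ZMod m)) (i : ZMod m) :
    ptsHom m r (Sum.inr i) = Sum.inr (r.2.toAdd + i) := rfl

theorem odd_card_aff_prod (hm : Odd m) : Odd (Nat.card (aff × Multiplicative (ZMod m))) := by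
  rw [Nat.card_prod, card_mul_zmod]
  exact odd_card_aff.mul hm

theorem slope_cube : ∀ i j : ZMod 7, i ≠ j → (j - i) ^ 3 = 1 ∨ (i - j) ^ 3 = 1 := by decide

theorem boundOn_ten : BoundOn (Pts 1) := by
  intro F _ _ M _ _ _ ρ
  have hR := odd_card_aff_prod (m := 1) odd_one
  have := h2_le_sum hR ρ (altOfOdd hR (ptsHom 1)) (a := Sum.inl (Sum.inr 0))
    (b := Sum.inl (Sum.inr 1)) (by decide)
    (fun _ => rfl) (fun _ => rfl) (ι := Fin 2)
    ![(Sum.inl (Sum.inl 0), Sum.inl (Sum.inl 1)), (Sum.inl (Sum.inl 0), Sum.inr 0)]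
    (fun _ => ⊤) ?_ (fun _ _ => Submodule.mem_top)
  · simp only [Fin.sum_univ_two, finrank_top] at this
    omega
  have h2 : ∀ k : Fin 2, k = 0 ∨ k = 1 := by decide
  rintro ((i | i) | i) ((j | j) | j) hia hib hja hjb hij
  · obtain h | h := slope_cube i j fun h => hij (by rw [h])
    · exact ⟨(affMk _ i h, 1), 0, Or.inl (by simp)⟩
    · exact ⟨(affMk _ j h, 1), 0, Or.inr (by simp)⟩
  · obtain rfl | rfl := h2 j <;> contradiction
  · exact ⟨(affT i, 1), 1, Or.inl ⟨by simp, congrArg Sum.inr (Subsingleton.elim _ _)⟩⟩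
  · obtain rfl | rfl := h2 i <;> contradiction
  · obtain rfl | rfl := h2 i <;> contradiction
  · obtain rfl | rfl := h2 i <;> contradiction
  · exact ⟨(affT j, 1), 1, Or.inr ⟨by simp, congrArg Sum.inr (Subsingleton.elim _ _)⟩⟩
  · obtain rfl | rfl := h2 j <;> contradiction
  · exact absurd (congrArg Sum.inr (Subsingleton.elim i j)) hij

end Points

theorem altEmb_commute {α Ω : Type*} [DecidableEq α] [Fintype α] [DecidableEq Ω] [Fintype Ω]
    (ι : α ↪ Ω) (k : alternatingGroup α) {g : alternatingGroup Ω}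
    (hg : ∀ i, (g : Perm Ω) (ι i) = ι i) : Commute g (altEmb ι k) := by
  have h : Perm.Disjoint (g : Perm Ω) (altEmb ι k : Perm Ω) := fun x => by
    by_cases hx : x ∈ Set.range ι
    · obtain ⟨i, rfl⟩ := hx
      exact Or.inl (hg i)
    · exact Or.inr (altEmb_apply_of_notMem ι k hx)
  exact Subtype.ext h.commute

section Local

variable {m : ℕ}

variable (m) in
/-- The points of the local subgroup. -/
abbrev Loc := Fin 3 ⊕ ZMod m

variable (m) in
/-- The embedding of the points of the local subgroup. -/
def locEmb : Loc m ↪ Pts m where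
  toFun := Sum.elim ![Sum.inl (Sum.inl 0), Sum.inl (Sum.inr 0), Sum.inl (Sum.inr 1)] Sum.inr
  inj' := by
    have h : Function.Injective (![Sum.inl 0, Sum.inr 0, Sum.inr 1] : Fin 3 → ZMod 7 ⊕ Fin 2) := by
      decide
    have h3 : ∀ i : Fin 3, (![Sum.inl (Sum.inl 0), Sum.inl (Sum.inr 0), Sum.inl (Sum.inr 1)] :
        Fin 3 → Pts m) i = Sum.inl (![Sum.inl 0, Sum.inr 0, Sum.inr 1] i) := by
      intro i
      fin_cases i <;> rfl
    rintro (i | i) (j | j) hij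
    · rw [Sum.elim_inl, Sum.elim_inl, h3, h3] at hij
      rw [h (Sum.inl_injective hij)]
    · rw [Sum.elim_inl, Sum.elim_inr, h3] at hij
      cases hij
    · rw [Sum.elim_inl, Sum.elim_inr, h3] at hij
      cases hij
    · exact congrArg Sum.inr (Sum.inr_injective hij)

@[simp] theorem locEmb_zero : locEmb m (Sum.inl 0) = Sum.inl (Sum.inl 0) := rfl
@[simp] theorem locEmb_one : locEmb m (Sum.inl 1) = Sum.inl (Sum.inr 0) := rfl
@[simp] theorem locEmb_two : locEmb m (Sum.inl 2) = Sum.inl (Sum.inr 1) := rfl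
@[simp] theorem locEmb_inr (c : ZMod m) : locEmb m (Sum.inr c) = Sum.inr c := rfl

variable [NeZero m]

/-- The normalizing subgroup of odd order. -/
def ptsAlt (hm : Odd m) : aff × Multiplicative (ZMod m) →* alternatingGroup (Pts m) :=
  altOfOdd (odd_card_aff_prod hm) (ptsHom m)

@[simp] theorem coe_ptsAlt (hm : Odd m) (r : aff × Multiplicative (ZMod m)) :
    (ptsAlt hm r : Perm (Pts m)) = ptsHom m r := rfl

variable (m) in
/-- The inclusion of the local subgroup. -/
noncomputable abbrev locHom : alternatingGroup (Loc m) →* alternatingGroup (Pts m) :=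
  altEmb (locEmb m)

variable (m) in
/-- The three-cycle of the local subgroup outside of the translated points. -/
abbrev locX : alternatingGroup (Loc m) := xA (Sum.inl 1) (Sum.inl 2) (Sum.inl 0)

/-- The three-cycles of the local subgroup through the translated points. -/
abbrev locC (c : ZMod m) : alternatingGroup (Loc m) := xA (Sum.inl 1) (Sum.inl 2) (Sum.inr c)

/-- The translations as elements of the local subgroup. -/
def locT (hm : Odd m) : Multiplicative (ZMod m) →* alternatingGroup (Loc m) :=
  altOfOdd (by rwa [card_mul_zmod])
    ((Perm.sumCongrHom (Fin 3) (ZMod m)).comp ((1 : _ →* Perm (Fin 3)).prod (transl m)))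

theorem locHom_locT (hm : Odd m) (t : Multiplicative (ZMod m)) :
    locHom m (locT hm t) = ptsAlt hm (1, t) := by
  refine Subtype.ext (Equiv.ext fun x => ?_)
  by_cases hx : x ∈ Set.range (locEmb m)
  · obtain ⟨i | i, rfl⟩ := hx
    · rw [altEmb_apply]
      fin_cases i <;> rfl
    · rw [altEmb_apply]
      rfl
  · rw [altEmb_apply_of_notMem _ _ hx]
    obtain (i | i) | i := x
    · simp
    · simp
    · exact absurd ⟨Sum.inr i, rfl⟩ hx

theorem locT_conj_locC (hm : Odd m) (t : Multiplicative (ZMod m)) (c : ZMod m) :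
    locT hm t * locC c * (locT hm t)⁻¹ = locC (t.toAdd + c) := by
  rw [conj_xA]
  rfl

theorem locHom_locX : locHom m (locX m) =
    xA (Sum.inl (Sum.inr 0)) (Sum.inl (Sum.inr 1)) (Sum.inl (Sum.inl 0)) := by
  rw [altEmb_xA]
  rfl

theorem locHom_locC (c : ZMod m) : locHom m (locC c) =
    xA (Sum.inl (Sum.inr 0)) (Sum.inl (Sum.inr 1)) (Sum.inr c) := by
  rw [altEmb_xA]
  rfl

theorem ptsAlt_conj_locX (hm : Odd m) (h : aff) :
    ptsAlt hm (h, 1) * locHom m (locX m) * (ptsAlt hm (h, 1))⁻¹ =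
      xA (Sum.inl (Sum.inr 0)) (Sum.inl (Sum.inr 1)) (Sum.inl (Sum.inl ((h : Perm (ZMod 7)) 0))) := by
  rw [locHom_locX, conj_xA]
  rfl

theorem ptsAlt_conj_locC (hm : Odd m) (h : aff) (c : ZMod m) :
    ptsAlt hm (h, 1) * locHom m (locC c) * (ptsAlt hm (h, 1))⁻¹ = locHom m (locC c) := by
  rw [locHom_locC, conj_xA]
  simp

theorem ptsAlt_affP_commute (hm : Odd m) (k : alternatingGroup (Loc m)) :
    Commute (ptsAlt hm (affP, 1)) (locHom m k) := by
  refine altEmb_commute _ k ?_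
  rintro (i | i)
  · fin_cases i <;> simp
  · simp

variable {F M : Type*} [Field F] [AddCommGroup M] [Module F M]
  {ρ : Representation F (alternatingGroup (Pts m)) M} {hm : Odd m}
  {f : ZN ρ (ptsAlt hm)} (s : alternatingGroup (Loc m) →* CExt f)

/-- The compatibility conditions for a splitting over the local subgroup. -/
structure LocSplit : Prop where
  /-- it covers the inclusion -/
  map_g : ∀ k, (s k).g = locHom m k
  /-- it extends the canonical splitting over the translations -/
  map_locT : ∀ t, s (locT hm t) = CExt.lift f (1, t)
  /-- it takes values that are fixed by an element of order three -/
  fix_locX : ρ (ptsAlt hm (affP, 1)) (s (locX m)).m = (s (locX m)).m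
  /-- one of its values is fixed by the affine group -/
  fix_locC : ∀ h, ρ (ptsAlt hm (h, 1)) (s (locC 0)).m = (s (locC 0)).m

variable {s}

theorem LocSplit.commute_locC (hs : LocSplit s) (h : aff) (c : ZMod m) :
    Commute (CExt.lift f (h, 1)) (s (locC c)) := by
  have h0 : Commute (CExt.lift f (h, 1)) (s (locC 0)) := by
    rw [commute_iff_eq, ← mul_inv_eq_iff_eq_mul, CExt.lift_conj, hs.map_g]
    ext
    · exact hs.fix_locC h
    · rw [ptsAlt_conj_locC, hs.map_g]
  have hT : Commute (CExt.lift f (h, 1)) (s (locT hm (Multiplicative.ofAdd c))) := by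
    rw [hs.map_locT]
    exact Commute.map (by simp [commute_iff_eq]) _
  have := locT_conj_locC hm (Multiplicative.ofAdd c) 0
  rw [toAdd_ofAdd, add_zero] at this
  rw [← this, map_mul, map_mul, map_inv]
  exact (hT.mul_right h0).mul_right hT.inv_right

theorem LocSplit.commute_locX (hs : LocSplit s) (c : ZMod 7) (hc : c ^ 3 = 1) :
    Commute (CExt.lift f (affMk c 0 hc, 1)) (s (locX m)) := by
  rw [commute_iff_eq, ← mul_inv_eq_iff_eq_mul, CExt.lift_conj, hs.map_g]
  ext
  · exact affMk_zero_fix (τ := ρ.comp ((ptsAlt hm).comp (MonoidHom.inl _ _))) hs.fix_locX c hc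
  · rw [ptsAlt_conj_locX, hs.map_g, locHom_locX]
    simp

/-- The lifts of the generating three-cycles. -/
def locY (s : alternatingGroup (Loc m) →* CExt f) : Pts m → CExt f
  | Sum.inl (Sum.inl i) => CExt.lift f (affT i, 1) * s (locX m) * (CExt.lift f (affT i, 1))⁻¹
  | Sum.inl (Sum.inr _) => 1
  | Sum.inr c => s (locC c)

theorem LocSplit.locY_affMk (hs : LocSplit s) (c i : ZMod 7) (hc : c ^ 3 = 1) :
    CExt.lift f (affMk c i hc, 1) * s (locX m) * (CExt.lift f (affMk c i hc, 1))⁻¹ =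
      locY s (Sum.inl (Sum.inl i)) := by
  have h : CExt.lift f (affMk c i hc, 1) = CExt.lift f (affT i, 1) *
      CExt.lift f (affMk c 0 hc, 1) := by
    rw [← map_mul, Prod.mk_mul_mk, ← affMk_eq_mul, one_mul]
  have h' := (hs.commute_locX c hc).eq
  rw [← mul_inv_eq_iff_eq_mul] at h'
  rw [h, locY, mul_inv_rev]
  nth_rewrite 2 [← h']
  group

theorem locX_pow_three : locX m ^ 3 = 1 := xA_pow_three (by simp) _

theorem locC_pow_three (c : ZMod m) : locC c ^ 3 = 1 := xA_pow_three (by simp) _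

/-- The essential relator. -/
def locRel (s : alternatingGroup (Loc m) →* CExt f) : CExt f :=
  (locY s (Sum.inl (Sum.inl 0)) * locY s (Sum.inl (Sum.inl 1))) ^ 2

theorem LocSplit.mem_B2 (hs : LocSplit s) (h01 : locRel s = 1) : f.1 ∈ B2 ρ := by
  have h2 : ∀ k : Fin 2, k = 0 ∨ k = 1 := by decide
  have hconj : ∀ (i j : ZMod 7) (h : (j - i) ^ 3 = 1),
      (locY s (Sum.inl (Sum.inl i)) * locY s (Sum.inl (Sum.inl j))) ^ 2 = 1 := by
    intro i j h
    have e : CExt.lift f (affMk (j - i) i h, 1) * CExt.lift f (affT 1, 1) =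
        CExt.lift f (affMk (j - i) j h, 1) := by
      rw [← map_mul, Prod.mk_mul_mk, one_mul]
      congr 2
      refine Subtype.ext (Equiv.ext fun x => ?_)
      simp
      ring
    have e0 : locY s (Sum.inl (Sum.inl 0)) = s (locX m) := by
      rw [← hs.locY_affMk 1 0 (one_pow 3), show affMk 1 0 (one_pow 3) = 1 from
        Subtype.ext (Equiv.ext fun x => by simp), ← Prod.one_eq_mk, map_one, one_mul, inv_one,
        mul_one]
    rw [locRel, e0, locY] at h01
    rw [← hs.locY_affMk (j - i) i h, ← hs.locY_affMk (j - i) j h, ← e]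
    have := CExt.conj_mul_pow (CExt.lift f (affMk (j - i) i h, 1)) (s (locX m))
      (CExt.lift f (affT 1, 1) * s (locX m) * (CExt.lift f (affT 1, 1))⁻¹)
    rw [h01, mul_one, mul_inv_cancel] at this
    rw [← this]
    group
  have hmix : ∀ (i : ZMod 7) (c : ZMod m),
      (locY s (Sum.inl (Sum.inl i)) * locY s (Sum.inr c)) ^ 2 = 1 := by
    intro i c
    have hc := (hs.commute_locC (affT i) c).eq
    rw [← mul_inv_eq_iff_eq_mul] at hc
    rw [locY, locY]
    nth_rewrite 1 [← hc]
    rw [CExt.conj_mul_pow, ← map_mul, ← map_pow, xA_mul_xA_sq (by simp) (by simp) (by simp)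
      (by simp) (by simp) (by simp), map_one, mul_one, mul_inv_cancel]
  refine mem_B2_of_lifts (a := Sum.inl (Sum.inr 0)) (b := Sum.inl (Sum.inr 1)) (by simp)
    (locY s) ?_ ?_ ?_
  · rintro ((i | i) | c) hia hib
    · rw [locY, CExt.lift_conj, hs.map_g]
      change ptsAlt hm (affT i, 1) * locHom m (locX m) * (ptsAlt hm (affT i, 1))⁻¹ = _
      rw [ptsAlt_conj_locX]
      simp
    · obtain rfl | rfl := h2 i <;> contradiction
    · rw [locY, hs.map_g, locHom_locC]
  · rintro ((i | i) | c) hia hib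
    · rw [locY, conj_pow, ← map_pow, locX_pow_three, map_one, mul_one, mul_inv_cancel]
    · obtain rfl | rfl := h2 i <;> contradiction
    · rw [locY, ← map_pow, locC_pow_three, map_one]
  · rintro ((i | i) | i) ((j | j) | j) hia hib hja hjb hij
    · obtain h | h := slope_cube i j fun h => hij (by rw [h])
      · exact hconj i j h
      · exact CExt.mul_pow_two_comm (hconj j i h)
    · obtain rfl | rfl := h2 j <;> contradiction
    · exact hmix i j
    · obtain rfl | rfl := h2 i <;> contradiction
    · obtain rfl | rfl := h2 i <;> contradiction
    · obtain rfl | rfl := h2 i <;> contradiction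
    · exact CExt.mul_pow_two_comm (hmix j i)
    · obtain rfl | rfl := h2 j <;> contradiction
    · rw [locY, locY, ← map_mul, ← map_pow, xA_mul_xA_sq (by simp) (by simp) (by simp)
        (by simp) (by simp) (by simpa using hij), map_one]

end Local

section Small

/-- A product of two transpositions. -/
def altSwap {Ω : Type*} [DecidableEq Ω] [Fintype Ω] (a b c d : Ω) (hab : a ≠ b) (hcd : c ≠ d) :
    alternatingGroup Ω :=
  ⟨swap a b * swap c d, by
    rw [Perm.mem_alternatingGroup, map_mul, Perm.sign_swap hab, Perm.sign_swap hcd]; decide⟩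

/-- The element of order three in the smallest case. -/
abbrev smallP : alternatingGroup (Pts 3) := ptsAlt (m := 3) (by decide) (affP, 1)

/-- An element conjugating `smallP`. -/
def smallA : alternatingGroup (Pts 3) :=
  altSwap (Sum.inl (Sum.inl 1)) (Sum.inr 0) (Sum.inl (Sum.inl 3)) (Sum.inl (Sum.inl 0))
    (by decide) (by decide)

/-- An element conjugating `smallP`. -/
def smallB : alternatingGroup (Pts 3) :=
  altSwap (Sum.inl (Sum.inl 4)) (Sum.inl (Sum.inl 0)) (Sum.inr 1) (Sum.inr 2)
    (by decide) (by decide)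

theorem eq_top_of_small (H : Subgroup (alternatingGroup (Pts 3)))
    (h0 : xA (Sum.inr 1) (Sum.inr 2) (Sum.inr 0) ∈ H)
    (hu : xA (Sum.inl (Sum.inr 0)) (Sum.inl (Sum.inr 1)) (Sum.inl (Sum.inl 0)) *
      xA (Sum.inl (Sum.inr 0)) (Sum.inl (Sum.inr 1)) (Sum.inl (Sum.inl 1)) ∈ H)
    (hA : smallA * smallP * smallA⁻¹ ∈ H) (hB : smallB * smallP * smallB⁻¹ ∈ H) : H = ⊤ := by
  have step : ∀ g ∈ H, (g : Perm (Pts 3)) (Sum.inr 1) = Sum.inr 1 →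
      (g : Perm (Pts 3)) (Sum.inr 2) = Sum.inr 2 → ∀ x y, (g : Perm (Pts 3)) x = y →
      xA (Sum.inr 1) (Sum.inr 2) x ∈ H → xA (Sum.inr 1) (Sum.inr 2) y ∈ H := by
    rintro g hg h1 h2 x _ rfl hx
    have := conj_xA g (Sum.inr 1) (Sum.inr 2) x
    rw [h1, h2] at this
    rw [← this]
    exact H.mul_mem (H.mul_mem hg hx) (H.inv_mem hg)
  have sA := step _ hA (by decide) (by decide)
  have sB := step _ hB (by decide) (by decide)
  have su := step _ hu (by decide) (by decide)
  have q2 := sA _ (Sum.inl (Sum.inl 2)) (by decide) h0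
  have q4 := sA _ (Sum.inl (Sum.inl 4)) (by decide) q2
  have q0 := sB _ (Sum.inl (Sum.inl 0)) (by decide) q2
  have q1 := sB _ (Sum.inl (Sum.inl 1)) (by decide) q0
  have q6 := sA _ (Sum.inl (Sum.inl 6)) (by decide) q0
  have q5 := sA _ (Sum.inl (Sum.inl 5)) (by decide) q6
  have q3 := sB _ (Sum.inl (Sum.inl 3)) (by decide) q5
  have qa := su _ (Sum.inl (Sum.inr 0)) (by decide) q0
  have qb := su _ (Sum.inl (Sum.inr 1)) (by decide) q1
  refine eq_top_of_xA_mem (a := Sum.inr 1) (b := Sum.inr 2) (by decide) H ?_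
  have h7 : ∀ i : ZMod 7, i = 0 ∨ i = 1 ∨ i = 2 ∨ i = 3 ∨ i = 4 ∨ i = 5 ∨ i = 6 := by decide
  have h2 : ∀ i : Fin 2, i = 0 ∨ i = 1 := by decide
  have h3 : ∀ i : ZMod 3, i = 0 ∨ i = 1 ∨ i = 2 := by decide
  rintro ((i | i) | i) h1 h2'
  · obtain rfl | rfl | rfl | rfl | rfl | rfl | rfl := h7 i <;> assumption
  · obtain rfl | rfl := h2 i <;> assumption
  · obtain rfl | rfl | rfl := h3 i
    · exact h0
    · contradiction
    · contradiction

end Small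

section Fixed

variable {m : ℕ} [NeZero m]

/-- The embedding of the points of the smallest case. -/
def smallEmb (e : ZMod 3 ↪ ZMod m) : Pts 3 ↪ Pts m := (Function.Embedding.refl _).sumMap e

theorem altEmb_smallP (hm : Odd m) (e : ZMod 3 ↪ ZMod m) :
    altEmb (smallEmb e) smallP = ptsAlt hm (affP, 1) := by
  refine Subtype.ext (Equiv.ext fun x => ?_)
  by_cases hx : x ∈ Set.range (smallEmb e)
  · obtain ⟨(i | i) | i, rfl⟩ := hx
    · rw [altEmb_apply]
      rfl
    · rw [altEmb_apply]
      rfl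
    · rw [altEmb_apply]
      simp [smallEmb]
  · rw [altEmb_apply_of_notMem _ _ hx]
    obtain (i | i) | i := x
    · exact absurd ⟨Sum.inl (Sum.inl i), rfl⟩ hx
    · exact absurd ⟨Sum.inl (Sum.inr i), rfl⟩ hx
    · simp

variable {F M : Type*} [Field F] [AddCommGroup M] [Module F M]
  {ρ : Representation F (alternatingGroup (Pts m)) M} {hm : Odd m}

theorem stab_eq_top (e : ZMod 3 ↪ ZMod m) {w : M}
    (hC : ∀ i j k : ZMod m, i ≠ j → k ≠ i → k ≠ j → ρ (xA (Sum.inr i) (Sum.inr j) (Sum.inr k)) w = w)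
    (hu : ρ (xA (Sum.inl (Sum.inr 0)) (Sum.inl (Sum.inr 1)) (Sum.inl (Sum.inl 0)) *
      xA (Sum.inl (Sum.inr 0)) (Sum.inl (Sum.inr 1)) (Sum.inl (Sum.inl 1))) w = w)
    (hA : ρ (altEmb (smallEmb e) smallA * ptsAlt hm (affP, 1) *
      (altEmb (smallEmb e) smallA)⁻¹) w = w)
    (hB : ρ (altEmb (smallEmb e) smallB * ptsAlt hm (affP, 1) *
      (altEmb (smallEmb e) smallB)⁻¹) w = w) : stab ρ w = ⊤ := by
  have h12 : e 1 ≠ e 2 := e.injective.ne (by decide)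
  have htop : (stab ρ w).comap (altEmb (smallEmb e)) = ⊤ := by
    refine eq_top_of_small _ ?_ ?_ ?_ ?_
    · rw [Subgroup.mem_comap, altEmb_xA]
      exact hC _ _ _ h12 (e.injective.ne (by decide)) (e.injective.ne (by decide))
    · rw [Subgroup.mem_comap, map_mul, altEmb_xA, altEmb_xA]
      exact hu
    · rw [Subgroup.mem_comap, map_mul, map_mul, map_inv, altEmb_smallP hm]
      exact hA
    · rw [Subgroup.mem_comap, map_mul, map_mul, map_inv, altEmb_smallP hm]
      exact hB
  refine eq_top_of_xA_mem (a := Sum.inr (e 1)) (b := Sum.inr (e 2)) (by simpa using h12) _ ?_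
  rintro (x | x) h1 h2
  · have : xA (Sum.inr 1) (Sum.inr 2) (Sum.inl x) ∈ (stab ρ w).comap (altEmb (smallEmb e)) :=
      htop ▸ Subgroup.mem_top _
    rw [Subgroup.mem_comap, altEmb_xA] at this
    exact this
  · exact hC _ _ _ h12 (by simpa using h1) (by simpa using h2)

variable {f : ZN ρ (ptsAlt hm)}

theorem CExt.fix_of_commute {G R : Type*} [Group G] [Group R] {ρ : Representation F G M}
    {φ : R →* G} {f : ZN ρ φ} {y a : CExt f} (h : Commute y a) (ha : a.g = 1) :
    ρ y.g a.m = a.m := by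
  have := congrArg CExt.m h.eq
  simpa [ha, ZN.one_left, ZN.one_right, add_comm] using this

variable {s : alternatingGroup (Loc m) →* CExt f}

theorem LocSplit.locY_g (hs : LocSplit s) (i : ZMod 7) : (locY s (Sum.inl (Sum.inl i))).g =
    xA (Sum.inl (Sum.inr 0)) (Sum.inl (Sum.inr 1)) (Sum.inl (Sum.inl i)) := by
  rw [locY, CExt.lift_conj, hs.map_g]
  change ptsAlt hm (affT i, 1) * locHom m (locX m) * (ptsAlt hm (affT i, 1))⁻¹ = _
  rw [ptsAlt_conj_locX]
  simp

theorem LocSplit.locRel_g (hs : LocSplit s) : (locRel s).g = 1 := by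
  rw [locRel, ← CExt.proj_apply, map_pow, map_mul, CExt.proj_apply, CExt.proj_apply, hs.locY_g,
    hs.locY_g]
  exact xA_mul_xA_sq (by simp) (by simp) (by simp) (by simp) (by simp)
    (by simpa using (by decide : (0 : ZMod 7) ≠ 1))

theorem LocSplit.fix_mul (hs : LocSplit s) :
    ρ (xA (Sum.inl (Sum.inr 0)) (Sum.inl (Sum.inr 1)) (Sum.inl (Sum.inl 0)) *
      xA (Sum.inl (Sum.inr 0)) (Sum.inl (Sum.inr 1)) (Sum.inl (Sum.inl 1))) (locRel s).m =
      (locRel s).m := by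
  rw [← hs.locY_g, ← hs.locY_g, ← CExt.mul_g]
  exact CExt.fix_of_commute (Commute.self_pow _ _) hs.locRel_g

variable (m) in
/-- The embedding of the points not moved by the affine group. -/
def outEmb : Fin 2 ⊕ ZMod m ↪ Loc m := (Fin.succEmb 2).sumMap (.refl _)

theorem LocSplit.commute_outEmb (hs : LocSplit s) (h : aff) (k : alternatingGroup (Fin 2 ⊕ ZMod m)) :
    Commute (CExt.lift f (h, 1)) (s (altEmb (outEmb m) k)) := by
  have htop := eq_top_of_xA_mem (a := (Sum.inl 0 : Fin 2 ⊕ ZMod m)) (b := Sum.inl 1) (by simp)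
    ((Subgroup.centralizer {CExt.lift f (h, 1)}).comap (s.comp (altEmb (outEmb m)))) ?_
  · have := htop ▸ Subgroup.mem_top k
    rw [Subgroup.mem_comap, Subgroup.mem_centralizer_singleton_iff] at this
    exact this.symm
  have h2 : ∀ k : Fin 2, k = 0 ∨ k = 1 := by decide
  rintro (i | c) h0 h1
  · obtain rfl | rfl := h2 i <;> contradiction
  · rw [Subgroup.mem_comap, Subgroup.mem_centralizer_singleton_iff, MonoidHom.comp_apply, altEmb_xA]
    exact (hs.commute_locC h c).eq.symm

theorem LocSplit.fix_xA (hs : LocSplit s) {i j k : ZMod m} :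
    ρ (xA (Sum.inr i) (Sum.inr j) (Sum.inr k)) (locRel s).m = (locRel s).m := by
  set d : alternatingGroup (Loc m) := xA (Sum.inr i) (Sum.inr j) (Sum.inr k) with hd
  have hdX : Commute (s d) (s (locX m)) := by
    refine Commute.map ?_ s
    rw [commute_iff_eq, ← mul_inv_eq_iff_eq_mul, conj_xA, hd, coe_xA,
      cyc_of_ne (by simp) (by simp) (by simp), cyc_of_ne (by simp) (by simp) (by simp),
      cyc_of_ne (by simp) (by simp) (by simp)]
  have hdL : ∀ h, Commute (s d) (CExt.lift f (h, 1)) := by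
    intro h
    have := hs.commute_outEmb h (xA (Sum.inr i) (Sum.inr j) (Sum.inr k))
    rw [altEmb_xA] at this
    exact this.symm
  have hdY : ∀ x, Commute (s d) (locY s (Sum.inl (Sum.inl x))) := fun x =>
    ((hdL _).mul_right hdX).mul_right (hdL _).inv_right
  have h1 := CExt.fix_of_commute (((hdY 0).mul_right (hdY 1)).pow_right 2) hs.locRel_g
  rwa [hs.map_g, hd, altEmb_xA] at h1

end Fixed

theorem finrank_range_le_of_ker_of_ker {F D V U N : Type*} [Field F] [AddCommGroup D] [Module F D]
    [AddCommGroup V] [Module F V] [AddCommGroup U] [Module F U] [AddCommGroup N] [Module F N]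
    [FiniteDimensional F D] [FiniteDimensional F U] [FiniteDimensional F N]
    (a : D →ₗ[F] V) (b : D →ₗ[F] U) (c : D →ₗ[F] N) (W : Submodule F N)
    (hc : ∀ d, b d = 0 → c d ∈ W) (h : ∀ d, b d = 0 → c d = 0 → a d = 0) :
    Module.finrank F (LinearMap.range a) ≤ Module.finrank F U + Module.finrank F W := by
  have h1 := finrank_range_le_of_ker a b
  have h2 := finrank_range_le_of_ker (a.domRestrict (LinearMap.ker b))
    ((c.domRestrict (LinearMap.ker b)).codRestrict W fun d => hc d d.2)
  have h3 : (LinearMap.ker ((c.domRestrict (LinearMap.ker b)).codRestrict W fun d => hc d d.2)).map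
      (a.domRestrict (LinearMap.ker b)) = ⊥ := by
    rw [eq_bot_iff]
    rintro _ ⟨d, hd, rfl⟩
    exact h d d.2 (congrArg Subtype.val hd)
  rw [LinearMap.range_domRestrict, h3, finrank_bot, zero_add] at h2
  have h4 := Submodule.finrank_le (LinearMap.range b)
  have h5 := Submodule.finrank_le (LinearMap.range
    ((c.domRestrict (LinearMap.ker b)).codRestrict W fun d => hc d d.2))
  omega

section Step

variable {m : ℕ} [NeZero m] {F M : Type*} [Field F] [AddCommGroup M] [Module F M]
  (ρ : Representation F (alternatingGroup (Pts m)) M) (hm : Odd m)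

/-- The vectors fixed by the element of order three of the affine group. -/
abbrev fixP : Submodule F M := fix ρ (ptsAlt hm (affP, 1))

theorem fixP_le_comap (k : alternatingGroup (Loc m)) :
    fixP ρ hm ≤ (fixP ρ hm).comap (ρ.comp (locHom m) k) := by
  intro x hx
  rw [Submodule.mem_comap, mem_fix]
  change ρ _ (ρ (locHom m k) x) = ρ (locHom m k) x
  rw [← Module.End.mul_apply, ← map_mul, (ptsAlt_affP_commute hm k).eq, map_mul,
    Module.End.mul_apply, mem_fix.1 hx]

/-- The action of the local subgroup on the fixed vectors of the commuting element of order
three. -/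
noncomputable abbrev locRep : Representation F (alternatingGroup (Loc m)) (fixP ρ hm) :=
  Representation.subrepresentation (ρ.comp (locHom m)) (fixP ρ hm) (fixP_le_comap ρ hm)

theorem locRep_coe (k : alternatingGroup (Loc m)) (x : fixP ρ hm) :
    (locRep ρ hm k x : M) = ρ (locHom m k) x := rfl

/-- The restriction of normalized cocycles to the local subgroup. -/
noncomputable def locRes : ZN ρ (ptsAlt hm) →ₗ[F]
    (alternatingGroup (Loc m) → alternatingGroup (Loc m) → fixP ρ hm) where
  toFun f k l := ⟨f.1 (locHom m k) (locHom m l), by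
    have := ZN.conj f (affP, 1) (locHom m k) (locHom m l)
    rw [(ptsAlt_affP_commute hm k).eq, (ptsAlt_affP_commute hm l).eq, mul_inv_cancel_right,
      mul_inv_cancel_right] at this
    exact this.symm⟩
  map_add' _ _ := rfl
  map_smul' _ _ := rfl

theorem locRes_coe (f : ZN ρ (ptsAlt hm)) (k l : alternatingGroup (Loc m)) :
    (locRes ρ hm f k l : M) = f.1 (locHom m k) (locHom m l) := rfl

theorem locRes_mem_Z2 (f : ZN ρ (ptsAlt hm)) : locRes ρ hm f ∈ Z2 (locRep ρ hm) := by
  intro g h j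
  refine Subtype.ext ?_
  have := ZN.cocycle f (locHom m g) (locHom m h) (locHom m j)
  rw [← map_mul, ← map_mul] at this
  exact this

/-- Normalized cocycles together with a normalized trivialization over the local subgroup. -/
noncomputable def LocTriv : Submodule F (ZN ρ (ptsAlt hm) × (alternatingGroup (Loc m) → fixP ρ hm)) where
  carrier := {d | locRes ρ hm d.1 = d1 (locRep ρ hm) d.2 ∧ ∀ t, d.2 (locT hm t) = 0}
  add_mem' {a b} ha hb := ⟨by
    rw [Prod.fst_add, Prod.snd_add, map_add, map_add, ha.1, hb.1], fun t => by
    rw [Prod.snd_add, Pi.add_apply, ha.2, hb.2, add_zero]⟩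
  zero_mem' := ⟨by rw [Prod.fst_zero, Prod.snd_zero, map_zero, map_zero], fun _ => rfl⟩
  smul_mem' c a ha := ⟨by
    rw [Prod.smul_fst, Prod.smul_snd, map_smul, map_smul, ha.1], fun t => by
    rw [Prod.smul_snd, Pi.smul_apply, ha.2, smul_zero]⟩

variable {ρ hm}

theorem exists_locTriv [CharP F 2] {f : ZN ρ (ptsAlt hm)} (hf : locRes ρ hm f ∈ B2 (locRep ρ hm)) :
    ∃ β, (f, β) ∈ LocTriv ρ hm := by
  obtain ⟨β, hβ⟩ := hf
  set σ := locRep ρ hm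
  have hT : ∀ t u, σ (locT hm t) (β (locT hm u)) = β (locT hm (t * u)) + β (locT hm t) := by
    intro t u
    have h1 := congrFun (congrFun hβ (locT hm t)) (locT hm u)
    have h2 : locRes ρ hm f (locT hm t) (locT hm u) = 0 := by
      refine Subtype.ext ?_
      rw [locRes_coe, locHom_locT, ZN.map_left]
      rfl
    rw [h2, d1_apply, ← map_mul] at h1
    rw [← neg_eq F (β (locT hm t))]
    linear_combination (norm := abel) h1
  let c : fixP ρ hm := ∑ u, β (locT hm u)
  have hc : ∀ t, σ (locT hm t) c = c + β (locT hm t) := by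
    intro t
    have hcard : Odd (Fintype.card (Multiplicative (ZMod m))) := by
      rwa [← Nat.card_eq_fintype_card, card_mul_zmod]
    have h3 : ∑ u, β (locT hm (t * u)) = c := Fintype.sum_equiv (Equiv.mulLeft t) _ _ fun _ => rfl
    rw [map_sum, Finset.sum_congr rfl fun u _ => hT t u, Finset.sum_add_distrib, h3,
      Finset.sum_const, Finset.card_univ, odd_nsmul F hcard]
  refine ⟨fun k => β k + (σ k c - c), ?_, fun t => ?_⟩
  · rw [← hβ]
    funext k l
    simp only [d1_apply, map_add, map_sub, map_mul, Module.End.mul_apply]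
    abel
  · change β (locT hm t) + (σ (locT hm t) c - c) = 0
    rw [hc, add_sub_cancel_left]
    exact add_self_eq_zero F _

/-- The splitting attached to a trivialization. -/
noncomputable def locSec [CharP F 2] (d : LocTriv ρ hm) : alternatingGroup (Loc m) →* CExt d.1.1 :=
  MonoidHom.mk' (fun k => ⟨d.1.2 k, locHom m k⟩) fun k l => by
    refine CExt.ext ?_ (map_mul (locHom m) k l)
    · have h := congrArg Subtype.val (congrFun (congrFun d.2.1 k) l)
      rw [locRes_coe, d1_apply] at h
      simp only [Submodule.coe_add, Submodule.coe_sub, locRep_coe] at h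
      rw [CExt.mul_m, h]
      have h2 := add_self_eq_zero F (d.1.2 k : M)
      have h3 := add_self_eq_zero F (ρ (locHom m k) (d.1.2 l : M))
      have h4 := neg_eq F (d.1.2 (k * l) : M)
      linear_combination (norm := abel) -h2 - h3 - h4

variable (ρ hm) in
/-- The obstruction against being fixed by the affine group. -/
noncomputable def locObs : LocTriv ρ hm →ₗ[F] fixP ρ hm ⧸ (fix ρ (ptsAlt hm (affT 1, 1))).comap (fixP ρ hm).subtype :=
  Submodule.mkQ _ ∘ₗ LinearMap.proj (locC 0) ∘ₗ LinearMap.snd _ _ _ ∘ₗ Submodule.subtype _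

theorem locSplit_locSec [CharP F 2] {d : LocTriv ρ hm} (hd : locObs ρ hm d = 0) :
    LocSplit (locSec d) where
  map_g _ := rfl
  map_locT t := CExt.ext (congrArg Subtype.val (d.2.2 t)) (locHom_locT hm t)
  fix_locX := (d.1.2 (locX m)).2
  fix_locC := aff_fix (τ := ρ.comp ((ptsAlt hm).comp (MonoidHom.inl _ _))) (d.1.2 (locC 0)).2
    ((Submodule.Quotient.mk_eq_zero _).1 hd)

variable (m) in
/-- The three-cycle attached to a point. -/
abbrev ptX (i : ZMod 7) : alternatingGroup (Pts m) :=
  xA (Sum.inl (Sum.inr 0)) (Sum.inl (Sum.inr 1)) (Sum.inl (Sum.inl i))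

variable (ρ hm) in
/-- The module component of the essential relator, as a linear map. -/
noncomputable def locRelMap : LocTriv ρ hm →ₗ[F] M where
  toFun d :=
    let A := ρ (ptsAlt hm (affT 0, 1)) (d.1.2 (locX m)) +
      ρ (ptX m 0) (ρ (ptsAlt hm (affT 1, 1)) (d.1.2 (locX m))) + d.1.1.1 (ptX m 0) (ptX m 1)
    A + ρ (ptX m 0 * ptX m 1) A + d.1.1.1 (ptX m 0 * ptX m 1) (ptX m 0 * ptX m 1)
  map_add' a b := by
    simp only [Submodule.coe_add, Prod.fst_add, Prod.snd_add, Pi.add_apply, map_add]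
    abel
  map_smul' c a := by
    simp only [Submodule.coe_smul, Prod.smul_fst, Prod.smul_snd, Pi.smul_apply, map_smul, smul_add,
      map_add, RingHom.id_apply]

theorem locRelMap_eq [CharP F 2] {d : LocTriv ρ hm} (hd : locObs ρ hm d = 0) :
    locRelMap ρ hm d = (locRel (locSec d)).m := by
  have h := locSplit_locSec hd
  have h1 : ∀ i, (locY (locSec d) (Sum.inl (Sum.inl i))).m =
      ρ (ptsAlt hm (affT i, 1)) (d.1.2 (locX m)) := fun i => by
    rw [locY, CExt.lift_conj]
    rfl
  rw [locRel, CExt.mul_pow_two_m, h1, h1, h.locY_g, h.locY_g]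
  rfl

variable (ρ) in
/-- The subspace containing the values of the essential relator. -/
def relSpace : Submodule F M :=
  fix ρ (ptX m 0 * ptX m 1) ⊓
    ⨅ (i : ZMod m) (j : ZMod m) (k : ZMod m), fix ρ (xA (Sum.inr i) (Sum.inr j) (Sum.inr k))

theorem locRelMap_mem [CharP F 2] {d : LocTriv ρ hm} (hd : locObs ρ hm d = 0) :
    locRelMap ρ hm d ∈ relSpace ρ := by
  rw [locRelMap_eq hd, relSpace]
  simp only [Submodule.mem_inf, Submodule.mem_iInf, mem_fix]
  exact ⟨(locSplit_locSec hd).fix_mul, fun i j k => (locSplit_locSec hd).fix_xA⟩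

theorem finrank_relSpace_le [FiniteDimensional F M] (hm : Odd m) (h3 : 3 ≤ m)
    (hinv : ∀ x, (∀ g, ρ g x = x) → x = 0) :
    Module.finrank F (relSpace ρ) ≤
      2 * (Module.finrank F M - Module.finrank F (fixP ρ hm)) := by
  obtain ⟨e⟩ : Nonempty (ZMod 3 ↪ ZMod m) :=
    Function.Embedding.nonempty_of_card_le (by simpa [ZMod.card] using h3)
  have h := finrank_le_sum_of_inf (relSpace ρ)
    ![fix ρ (altEmb (smallEmb e) smallA * ptsAlt hm (affP, 1) * (altEmb (smallEmb e) smallA)⁻¹),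
      fix ρ (altEmb (smallEmb e) smallB * ptsAlt hm (affP, 1) * (altEmb (smallEmb e) smallB)⁻¹)]
    fun x hx hx' => hinv x fun g => ?_
  · rw [Fin.sum_univ_two] at h
    change _ ≤ Module.finrank F M - Module.finrank F (fix ρ _) +
      (Module.finrank F M - Module.finrank F (fix ρ _)) at h
    rwa [finrank_fix_conj, finrank_fix_conj, ← two_mul] at h
  · simp only [relSpace, Submodule.mem_inf, Submodule.mem_iInf, mem_fix] at hx
    have := stab_eq_top (hm := hm) e (fun i j k _ _ _ => hx.2 i j k) hx.1 (hx' 0) (hx' 1)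
    exact mem_stab.1 (this ▸ Subgroup.mem_top g)

theorem finrank_range_locTriv_le [CharP F 2] [FiniteDimensional F M] :
    Module.finrank F (LinearMap.range ((B2 ρ).mkQ ∘ₗ (ZN ρ (ptsAlt hm)).subtype ∘ₗ
      LinearMap.fst _ _ _ ∘ₗ (LocTriv ρ hm).subtype)) ≤
    Module.finrank F (fixP ρ hm ⧸ (fix ρ (ptsAlt hm (affT 1, 1))).comap (fixP ρ hm).subtype) +
      Module.finrank F (relSpace ρ) := by
  have key := finrank_range_le_of_ker_of_ker (D := LocTriv ρ hm) ((B2 ρ).mkQ ∘ₗ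
    (ZN ρ (ptsAlt hm)).subtype ∘ₗ LinearMap.fst _ _ _ ∘ₗ (LocTriv ρ hm).subtype) (locObs ρ hm)
    (locRelMap ρ hm) (relSpace ρ) fun d hd => locRelMap_mem hd
  refine key fun d hd h0 => ?_
  have hs := locSplit_locSec hd
  rw [locRelMap_eq hd, ← CExt.eq_one_iff_of_g hs.locRel_g] at h0
  have h1 := hs.mem_B2 h0
  rw [← Submodule.Quotient.mk_eq_zero] at h1
  exact h1

theorem finrank_fixP_le [CharP F 2] [FiniteDimensional F M] :
    2 * Module.finrank F
      (fixP ρ hm ⧸ (fix ρ (ptsAlt hm (affT 1, 1))).comap (fixP ρ hm).subtype) ≤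
    Module.finrank F M - Module.finrank F (fixP ρ hm) := by
  have h1 := Submodule.finrank_quotient_add_finrank
    ((fix ρ (ptsAlt hm (affT 1, 1))).comap (fixP ρ hm).subtype)
  have h2 : 3 * Module.finrank F (fixP ρ hm) ≤ Module.finrank F M + 2 * Module.finrank F
      ((fix ρ (ptsAlt hm (affT 1, 1))).comap (fixP ρ hm).subtype) := finrank_fix_frobenius ρ (p := ptsAlt hm (affP, 1)) (v := ptsAlt hm (affT 1, 1))
    (by rw [← map_mul, ← map_pow, ← map_mul, Prod.pow_mk, Prod.mk_mul_mk, Prod.mk_mul_mk, affP_mul_affT, one_pow])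
    (by rw [← map_pow, Prod.pow_mk, affT_pow_seven, one_pow, ← Prod.one_eq_mk, map_one])
  omega

theorem h2_le_locRep_add [CharP F 2] [FiniteDimensional F M] :
    h2 ρ ≤ Module.finrank F (LinearMap.range ((B2 ρ).mkQ ∘ₗ (ZN ρ (ptsAlt hm)).subtype ∘ₗ
      LinearMap.fst _ _ _ ∘ₗ (LocTriv ρ hm).subtype)) + h2 (locRep ρ hm) := by
  have h1 : h2 ρ ≤ Module.finrank F ((ZN ρ (ptsAlt hm)).map (B2 ρ).mkQ) :=
    h2_le_of_sup ρ (Z2_le_ZN_sup (odd_card_aff_prod hm) ρ (ptsAlt hm))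
  have h2 := finrank_range_le_of_ker ((B2 ρ).mkQ.domRestrict (ZN ρ (ptsAlt hm)))
    ((B2 (locRep ρ hm)).mkQ ∘ₗ locRes ρ hm)
  rw [LinearMap.range_domRestrict] at h2
  refine h1.trans (h2.trans (add_le_add (Submodule.finrank_mono ?_) (Submodule.finrank_mono ?_)))
  · rintro _ ⟨f, hf, rfl⟩
    obtain ⟨β, hβ⟩ := exists_locTriv ((Submodule.Quotient.mk_eq_zero _).1 hf)
    exact ⟨⟨(f, β), hβ⟩, rfl⟩
  · rintro _ ⟨f, rfl⟩
    exact ⟨_, locRes_mem_Z2 ρ hm f, rfl⟩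

theorem h2_le_locRep [CharP F 2] [FiniteDimensional F M] (h3 : 3 ≤ m)
    (hinv : ∀ x, (∀ g, ρ g x = x) → x = 0) :
    2 * h2 ρ ≤ 2 * h2 (locRep ρ hm) + 5 * (Module.finrank F M - Module.finrank F (fixP ρ hm)) := by
  have h1 := h2_le_locRep_add (ρ := ρ) (hm := hm)
  have h2 := finrank_range_locTriv_le (ρ := ρ) (hm := hm)
  have h4 := finrank_fixP_le (ρ := ρ) (hm := hm)
  have h5 := finrank_relSpace_le hm h3 hinv
  omega

theorem boundOn_pts (hm : Odd m) (h3 : 3 ≤ m) (h : BoundOn (Loc m)) : BoundOn (Pts m) := by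
  refine boundOn_of_invariants (a := Sum.inl (Sum.inr 0)) (b := Sum.inl (Sum.inr 1))
    (p := Sum.inl (Sum.inl 0)) (q := Sum.inl (Sum.inl 1)) (by simp) (by simp) (by simp) (by simp)
    (by simp) (by simpa using (by decide : (0 : ZMod 7) ≠ 1)) ?_
  intro F _ _ M _ _ _ ρ hinv
  have h1 := h2_le_locRep (hm := hm) h3 hinv
  have h2 := h F _ (locRep ρ hm)
  have h4 := Submodule.finrank_le (fixP ρ hm)
  omega

end Step

theorem boundOn_fin (n : ℕ) (hn : 4 < n) : BoundOn (Fin n) := by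
  have hl (α : Type) : Nontrivial (α ⊕ Fin 2) := Sum.inr_injective.nontrivial
  have hr (α : Type) : Nontrivial ((ZMod 7 ⊕ Fin 2) ⊕ α) := Sum.inl_injective.nontrivial
  induction n using Nat.strong_induction_on with
  | _ n ih =>
    rcases Nat.even_or_odd n with he | ho
    · obtain rfl | rfl | rfl | h : n = 6 ∨ n = 8 ∨ n = 10 ∨ 12 ≤ n := by
        obtain ⟨k, rfl⟩ := he
        omega
      · exact boundOn_six.of_card_eq (by simp [ZMod.card])
      · exact boundOn_eight.of_card_eq (by simp [ZMod.card])
      · exact boundOn_ten.of_card_eq (by simp [ZMod.card])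
      · obtain ⟨m, rfl⟩ : ∃ m, n = m + 9 := ⟨n - 9, by omega⟩
        have hm : Odd m := by
          obtain ⟨k, hk⟩ := he
          exact ⟨k - 5, by omega⟩
        have : NeZero m := ⟨by omega⟩
        have : Nontrivial (Fin (m + 3)) := Fin.nontrivial_iff_two_le.2 (by omega)
        have h1 : BoundOn (Loc m) := (ih (m + 3) (by omega) (by omega)).of_card_eq
          (by simp [ZMod.card]; omega)
        exact (boundOn_pts hm (by omega) h1).of_card_eq (by simp [ZMod.card]; omega)
    · obtain rfl | h : n = 5 ∨ 7 ≤ n := by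
        obtain ⟨k, rfl⟩ := ho
        omega
      · exact boundOn_five.of_card_eq (by simp [ZMod.card])
      · obtain ⟨l, rfl⟩ : ∃ l, n = l + 1 := ⟨n - 1, by omega⟩
        have : Nontrivial (Fin l) := Fin.nontrivial_iff_two_le.2 (by omega)
        exact (ih l (by omega) (by omega)).of_card_add_one (by simp) (by simpa using ho)

section GroupCohomology

variable {F G M : Type} [Field F] [Group G] [AddCommGroup M] [Module F M]
  (ρ : Representation F G M)

/-- The cocycles of the library in curried form. -/
def curryCocycle : groupCohomology.cocycles₂ (Rep.of ρ) →ₗ[F] (G → G → M) where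
  toFun f g h := f (g, h)
  map_add' _ _ := rfl
  map_smul' _ _ := rfl

theorem curryCocycle_mem (f : groupCohomology.cocycles₂ (Rep.of ρ)) : curryCocycle ρ f ∈ Z2 ρ := by
  intro g h j
  exact (groupCohomology.mem_cocycles₂_def f.1).1 f.2 g h j

theorem finrank_groupCohomology_le [Finite G] [FiniteDimensional F M] :
    Module.finrank F (groupCohomology (Rep.of ρ) 2) ≤ h2 ρ := by
  let π : groupCohomology.cocycles₂ (Rep.of ρ) →ₗ[F] groupCohomology (Rep.of ρ) 2 :=
    (groupCohomology.H2π (Rep.of ρ)).hom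
  have hπ : Function.Surjective π := fun x =>
    groupCohomology.H2_induction_on x fun y => ⟨y, rfl⟩
  let κ : groupCohomology.cocycles₂ (Rep.of ρ) →ₗ[F] (G → G → M) ⧸ B2 ρ :=
    (B2 ρ).mkQ ∘ₗ curryCocycle ρ
  have hκ : LinearMap.range κ ≤ (Z2 ρ).map (B2 ρ).mkQ := by
    rintro _ ⟨f, rfl⟩
    exact ⟨_, curryCocycle_mem ρ f, rfl⟩
  have hker : LinearMap.ker κ ≤ LinearMap.ker π := by
    intro f hf
    obtain ⟨β, hβ⟩ := (Submodule.Quotient.mk_eq_zero _).1 (LinearMap.mem_ker.1 hf)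
    refine (groupCohomology.H2π_eq_zero_iff f).2 ⟨β, ?_⟩
    funext x
    exact congrFun (congrFun hβ x.1) x.2
  have : FiniteDimensional F (groupCohomology.cocycles₂ (Rep.of ρ)) := by
    have : FiniteDimensional F (G × G → M) := inferInstance
    exact FiniteDimensional.finiteDimensional_submodule (V := G × G → M) _
  have h1 := LinearMap.finrank_range_add_finrank_ker π
  have h2' := LinearMap.finrank_range_add_finrank_ker κ
  rw [LinearMap.range_eq_top.2 hπ, finrank_top] at h1
  have h3 := Submodule.finrank_mono hker
  have h4 := Submodule.finrank_mono hκ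
  rw [h2]
  omega

end GroupCohomology

end AltH2

/-- Let `n > 4`, `G = Aₙ`, `F` a field of characteristic `2` and `M` a finite-dimensional
`FG`-module.  Then `dim H²(G,M) ≤ (35/12) · dim M`, i.e. `12 · dim H²(G,M) ≤ 35 · dim M`. -/
theorem stmt_4 (n : ℕ) (hn : 4 < n)
    (F : Type) [Field F] [CharP F 2]
    (M : Type) [AddCommGroup M] [Module F M] [FiniteDimensional F M]
    (ρ : Representation F (alternatingGroup (Fin n)) M) :
    12 * Module.finrank F (groupCohomology (Rep.of ρ) 2) ≤ 35 * Module.finrank F M :=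
  (Nat.mul_le_mul_left 12 (AltH2.finrank_groupCohomology_le ρ)).trans (AltH2.boundOn_fin n hn F M ρ)
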